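/- Lower bound on the closest reachable point on the +x-axis when l − r ≡ 0 (mod 4): Let σ be a turn sequence with l L's and r R's, l − r ≥ 0 and l − r ≡ 0 (mod 4), and let C be any chain realizing σ whose endpoint is p = (a, 0) with a > 0. (i) If l − r ≥ 8 and σ₁ = L, then a ≥ min{₊ₓm₊ᵧᵒ(C), ₊ₓm₋ᵧᵖ(C), 2} + ⌊(l − r + 2)/4⌋; if l − r ≥ 8 and σ₁ = R, then a ≥ ⌊(l − r + 2)/4⌋ + 2. (ii) If l − r = 0 and σ₁ = L, then a ≥ min{₊ₓm₊ᵧᵒ(C), ₊ₓm₋ᵧᵖ(C), 2} + 2; if l − r = 0 and σ₁ = R, then a ≥ min{₊ₓm₋ᵧᵒ(C), ₊ₓm₊ᵧᵖ(C), 2} + 2. (iii) If l − r = 4, then a ≥ 3. -/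

import Mathlib

/-- A turn: left (`L`) or right (`R`). -/
inductive Turn : Type
  | L : Turn
  | R : Turn
  deriving DecidableEq

/-- Rotation of a direction vector by 90° counterclockwise. -/
def rotCCW (d : ℤ × ℤ) : ℤ × ℤ := (-d.2, d.1)

/-- Rotation of a direction vector by 90° clockwise. -/
def rotCW (d : ℤ × ℤ) : ℤ × ℤ := (d.2, -d.1)

/-- Unit direction of the axis-parallel segment from `u` to `v`. -/
def unitDir (u v : ℤ × ℤ) : ℤ × ℤ := ((v.1 - u.1).sign, (v.2 - u.2).sign)

/-- The set of integer points on the axis-parallel closed segment from `u` to `v`. -/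
def segSet (u v : ℤ × ℤ) : Set (ℤ × ℤ) :=
  {q | min u.1 v.1 ≤ q.1 ∧ q.1 ≤ max u.1 v.1 ∧ min u.2 v.2 ≤ q.2 ∧ q.2 ≤ max u.2 v.2}

/-- A simple rectilinear chain realizing the turn sequence `σ = σ₁⋯σₙ` (as a list,
`σ.get ⟨i, _⟩` is the `(i+1)`-st turn `σ_{i+1}`).  It consists of the points
`pts 0, …, pts (n+1)` with `pts 0 = (0,0)`; consecutive points span nondegenerate
axis-parallel segments, the first segment heads east, the chain turns left (CCW) or
right (CW) at each bend as prescribed by `σ`, and the chain is simple. -/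
structure Chain (σ : List Turn) where
  pts : ℕ → ℤ × ℤ
  start_eq : pts 0 = (0, 0)
  first_seg : ∃ t : ℤ, 0 < t ∧ pts 1 = (t, 0)
  axis_parallel : ∀ i ≤ σ.length,
    ((pts (i + 1)).1 = (pts i).1 ∧ (pts (i + 1)).2 ≠ (pts i).2) ∨
    ((pts (i + 1)).2 = (pts i).2 ∧ (pts (i + 1)).1 ≠ (pts i).1)
  turns : ∀ i, ∀ h : i < σ.length,
    unitDir (pts (i + 1)) (pts (i + 2)) =
      (if σ.get ⟨i, h⟩ = Turn.L then rotCCW else rotCW) (unitDir (pts i) (pts (i + 1)))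
  simple_adj : ∀ i, i + 1 ≤ σ.length →
    segSet (pts i) (pts (i + 1)) ∩ segSet (pts (i + 1)) (pts (i + 2)) = {pts (i + 1)}
  simple_nonadj : ∀ i j, i + 1 < j → j ≤ σ.length →
    segSet (pts i) (pts (i + 1)) ∩ segSet (pts j) (pts (j + 1)) = ∅

/-- `A(σ)`: the set of points reachable by the turn sequence `σ`. -/
def ReachSet (σ : List Turn) : Set (ℤ × ℤ) :=
  {q | ∃ C : Chain σ, C.pts (σ.length + 1) = q}

/-- The halfplane `V⁺(p)` (requires `p.1 ≠ 0` to be meaningful). -/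
def Vplus (p : ℤ × ℤ) : Set (ℤ × ℤ) :=
  {q | ∃ i j : ℤ, 0 ≤ i ∧ q = (p.1 + p.1.sign * i, j)}

/-- The halfplane `H⁺(p)` (requires `p.2 ≠ 0` to be meaningful). -/
def Hplus (p : ℤ × ℤ) : Set (ℤ × ℤ) :=
  {q | ∃ i j : ℤ, 0 ≤ j ∧ q = (i, p.2 + p.2.sign * j)}

/-- The quadrant `Q⁺(p)`. -/
def Qplus (p : ℤ × ℤ) : Set (ℤ × ℤ) := Vplus p ∩ Hplus p

/-- A staircase: consecutive turns always differ. -/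
def IsStaircase (σ : List Turn) : Prop := σ.Chain' (· ≠ ·)

/-- The prefix number `δᵢ`: number of `L`s minus number of `R`s among the first `i` turns. -/
def delta (σ : List Turn) (i : ℕ) : ℤ :=
  ((σ.take i).count Turn.L : ℤ) - ((σ.take i).count Turn.R : ℤ)

/-- The excess number `l - r` of a turn sequence. -/
def excess (σ : List Turn) : ℤ := (σ.count Turn.L : ℤ) - (σ.count Turn.R : ℤ)

/-- `σ` has a hook (two equal consecutive turns, at 1-based positions `k+1, k+2`)
whose prefix number is `≡ d (mod 4)`: `d = 0, 1, 2, 3` for right, up, left, down hooks. -/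
def HasHook (σ : List Turn) (d : ℤ) : Prop :=
  ∃ k, ∃ h : k + 1 < σ.length,
    σ.get ⟨k, by omega⟩ = σ.get ⟨k + 1, h⟩ ∧ delta σ (k + 1) % 4 = d

/-- `σ` has some hook, i.e. two equal consecutive turns. -/
def HasAnyHook (σ : List Turn) : Prop :=
  ∃ k, ∃ h : k + 1 < σ.length, σ.get ⟨k, by omega⟩ = σ.get ⟨k + 1, h⟩

/-- A set `S ⊆ ℤ²` is connected: any two points of `S` are joined by a path inside `S`
whose consecutive points are at `L¹`-distance `1`. -/
def GridConnected (S : Set (ℤ × ℤ)) : Prop :=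
  ∀ p ∈ S, ∀ q ∈ S, ∃ (n : ℕ) (f : ℕ → ℤ × ℤ),
    f 0 = p ∧ f n = q ∧ (∀ i ≤ n, f i ∈ S) ∧
    ∀ i < n, |(f (i + 1)).1 - (f i).1| + |(f (i + 1)).2 - (f i).2| = 1

/-- `q` lies on the boundary of the smallest axis-parallel bounding box of the chain `C`
(for `q` a point of the chain: it attains an extreme coordinate). -/
def OnBBoxBoundary (σ : List Turn) (C : Chain σ) (q : ℤ × ℤ) : Prop :=
  (∀ i ≤ σ.length + 1, q.1 ≤ (C.pts i).1) ∨ (∀ i ≤ σ.length + 1, (C.pts i).1 ≤ q.1) ∨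
  (∀ i ≤ σ.length + 1, q.2 ≤ (C.pts i).2) ∨ (∀ i ≤ σ.length + 1, (C.pts i).2 ≤ q.2)

/-- The last segment of the chain `C` is entirely contained in one side of the smallest
axis-parallel bounding box of `C`. -/
def LastSegOnSide (σ : List Turn) (C : Chain σ) : Prop :=
  ((C.pts σ.length).1 = (C.pts (σ.length + 1)).1 ∧
     ∀ i ≤ σ.length + 1, (C.pts σ.length).1 ≤ (C.pts i).1) ∨
  ((C.pts σ.length).1 = (C.pts (σ.length + 1)).1 ∧
     ∀ i ≤ σ.length + 1, (C.pts i).1 ≤ (C.pts σ.length).1) ∨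
  ((C.pts σ.length).2 = (C.pts (σ.length + 1)).2 ∧
     ∀ i ≤ σ.length + 1, (C.pts σ.length).2 ≤ (C.pts i).2) ∨
  ((C.pts σ.length).2 = (C.pts (σ.length + 1)).2 ∧
     ∀ i ≤ σ.length + 1, (C.pts i).2 ≤ (C.pts σ.length).2)

/-- The turn `σₘ` (1-based indexing). -/
def turnAt (σ : List Turn) (m : ℕ) : Turn := σ.getD (m - 1) Turn.L

/-- The suffix `σ_k ⋯ σ_n` contains no hook and all its prefix numbers `δᵢ`,
`k - 1 ≤ i ≤ n`, are `≡ 1` or `2 (mod 4)` (the combinatorial description of a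
NW-staircase containing the endpoint). -/
def GoodSuffix (σ : List Turn) (k : ℕ) : Prop :=
  1 ≤ k ∧ k ≤ σ.length ∧
  (∀ m : ℕ, k ≤ m → m < σ.length → turnAt σ m ≠ turnAt σ (m + 1)) ∧
  (∀ i : ℕ, k - 1 ≤ i → i ≤ σ.length → delta σ i % 4 = 1 ∨ delta σ i % 4 = 2)

open Classical in
/-- `₋ₓm₊ᵧᵖ(σ)`: taking the longest good suffix (i.e. the least `k` with
`GoodSuffix σ k`), the number of indices `i` with `k - 1 ≤ i ≤ n` and
`δᵢ ≡ 1 (mod 4)`; `0` if no good suffix exists. -/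
noncomputable def mNWp (σ : List Turn) : ℕ :=
  if ∃ k, GoodSuffix σ k then
    Nat.card {i : ℕ // sInf {k | GoodSuffix σ k} - 1 ≤ i ∧ i ≤ σ.length ∧
      delta σ i % 4 = 1}
  else 0

/-- The number of vertical segments of the chain `C` meeting the closed horizontal
segment from the origin to `(a, 0)`. -/
def verticalCrossCount (σ : List Turn) (C : Chain σ) (a : ℤ) : ℕ :=
  ((Finset.range (σ.length + 1)).filter fun i =>
    (C.pts i).1 = (C.pts (i + 1)).1 ∧
    0 ≤ (C.pts i).1 ∧ (C.pts i).1 ≤ a ∧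
    min (C.pts i).2 (C.pts (i + 1)).2 ≤ 0 ∧ 0 ≤ max (C.pts i).2 (C.pts (i + 1)).2).card

/-- The unit direction of the `(i+1)`-st segment of the chain `C`. -/
def dirOf (σ : List Turn) (C : Chain σ) (i : ℕ) : ℤ × ℤ := unitDir (C.pts i) (C.pts (i + 1))

/-- `z₁mz₂ᵒ(C)`: the number of `z₂`-segments in the maximal `(z₁,z₂)`-staircase subchain
of `C` containing the origin (the longest prefix of segments directed `z₁` or `z₂`);
`0` if no such subchain exists. -/
noncomputable def stairCountO (σ : List Turn) (C : Chain σ) (z₁ z₂ : ℤ × ℤ) : ℕ :=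
  Nat.card {i : ℕ // i ≤ σ.length ∧ dirOf σ C i = z₂ ∧
    ∀ j ≤ i, dirOf σ C j = z₁ ∨ dirOf σ C j = z₂}

/-- `z₁mz₂ᵖ(C)`: the number of `z₂`-segments in the maximal `(z₁,z₂)`-staircase subchain
of `C` containing the endpoint (the longest suffix of segments directed `z₁` or `z₂`);
`0` if no such subchain exists. -/
noncomputable def stairCountP (σ : List Turn) (C : Chain σ) (z₁ z₂ : ℤ × ℤ) : ℕ :=
  Nat.card {i : ℕ // i ≤ σ.length ∧ dirOf σ C i = z₂ ∧
    ∀ j, i ≤ j → j ≤ σ.length → dirOf σ C j = z₁ ∨ dirOf σ C j = z₂}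

/-- A self-avoiding walk on the square lattice, visiting `(X n, Y n)` for `n ≤ m`; the step out of
the `n`-th vertex points in the direction obtained from `+x` by `D n` counterclockwise quarter
turns, and the walk never reverses. -/
structure LatticeWalk where
  m : ℕ
  X : ℕ → ℤ
  Y : ℕ → ℤ
  D : ℕ → ℤ
  step : ∀ n < m,
    (D n % 4 = 0 ∧ X (n + 1) = X n + 1 ∧ Y (n + 1) = Y n) ∨
    (D n % 4 = 1 ∧ X (n + 1) = X n ∧ Y (n + 1) = Y n + 1) ∨
    (D n % 4 = 2 ∧ X (n + 1) = X n - 1 ∧ Y (n + 1) = Y n) ∨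
    (D n % 4 = 3 ∧ X (n + 1) = X n ∧ Y (n + 1) = Y n - 1)
  turn : ∀ n, n + 1 < m → D (n + 1) - D n ≤ 1 ∧ -1 ≤ D (n + 1) - D n
  inj : ∀ i j, i < j → j ≤ m → X i = X j → Y i = Y j → False

namespace LatticeWalk

/-- The octant of a nonzero lattice vector: even values are the half-axes, odd values the open
quadrants, counterclockwise from the positive `x`-axis. -/
def oct (x y : ℤ) : ℤ :=
  if y = 0 then (if 0 < x then 0 else 4)
  else if 0 < y then (if 0 < x then 1 else if x = 0 then 2 else 3)
  else (if x < 0 then 5 else if x = 0 then 6 else 7)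

/-- The signed octant change between two neighbouring nonzero lattice vectors. -/
def inc (x y x' y' : ℤ) : ℤ := (oct x' y' - oct x y + 1) % 8 - 1

/-- Two lattice vectors differ by a unit vector. -/
def Nbr (x y x' y' : ℤ) : Prop :=
  (x' = x ∧ (y' = y + 1 ∨ y' = y - 1)) ∨ (y' = y ∧ (x' = x + 1 ∨ x' = x - 1))

theorem inc_eq_oct_sub {x y x' y' : ℤ} (h : Nbr x y x' y') (h0 : ¬(x = 0 ∧ y = 0))
    (h1 : ¬(x' = 0 ∧ y' = 0)) :
    inc x y x' y' = oct x' y' - oct x y +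
      8 * ((if 0 < x ∧ y = -1 ∧ y' = 0 then 1 else 0) -
        (if 0 < x ∧ y = 0 ∧ y' = -1 then 1 else 0)) := by
  unfold Nbr at h
  rcases h with ⟨rfl, rfl | rfl⟩ | ⟨rfl, rfl | rfl⟩ <;> unfold inc oct <;> split_ifs <;> omega

theorem inc_bounds {x y x' y' : ℤ} (h : Nbr x y x' y') (h0 : ¬(x = 0 ∧ y = 0))
    (h1 : ¬(x' = 0 ∧ y' = 0)) : -1 ≤ inc x y x' y' ∧ inc x y x' y' ≤ 1 := by
  unfold Nbr at h
  rcases h with ⟨rfl, rfl | rfl⟩ | ⟨rfl, rfl | rfl⟩ <;> unfold inc oct <;> split_ifs <;> omega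

variable (W : LatticeWalk)

theorem nbr_row {i n : ℕ} (h : n < W.m) :
    Nbr (W.X n - W.X i) (W.Y n - W.Y i) (W.X (n + 1) - W.X i) (W.Y (n + 1) - W.Y i) := by
  have := W.step n h
  unfold Nbr; omega

theorem nbr_col {i n : ℕ} (h : n < W.m) :
    Nbr (W.X i - W.X n) (W.Y i - W.Y n) (W.X i - W.X (n + 1)) (W.Y i - W.Y (n + 1)) := by
  have := W.step n h
  unfold Nbr; omega

theorem sub_ne_zero {i j : ℕ} (h : i < j) (hj : j ≤ W.m) :
    ¬(W.X j - W.X i = 0 ∧ W.Y j - W.Y i = 0) := fun h' =>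
  W.inj i j h hj (by omega) (by omega)

/-- Change of the octant of the secant from vertex `i`, as its far end moves from `l` to `l+1`. -/
def incFar (i l : ℕ) : ℤ :=
  inc (W.X l - W.X i) (W.Y l - W.Y i) (W.X (l + 1) - W.X i) (W.Y (l + 1) - W.Y i)

/-- Change of the octant of the secant to vertex `j`, as its near end moves from `i` to `i+1`. -/
def incNear (j i : ℕ) : ℤ :=
  inc (W.X j - W.X i) (W.Y j - W.Y i) (W.X j - W.X (i + 1)) (W.Y j - W.Y (i + 1))

/-- The lifted octant of the secant from vertex `i` to vertex `j`. -/
def secant (i j : ℕ) : ℤ := 2 * W.D i + ∑ l ∈ Finset.Ico (i + 1) j, W.incFar i l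

theorem incFar_corner {i : ℕ} (h : i + 1 < W.m) :
    W.incFar i (i + 1) + W.incNear (i + 2) i = 2 * W.D (i + 1) - 2 * W.D i := by
  have h1 := W.step i (by omega)
  have h2 := W.step (i + 1) h
  have h3 := W.turn i h
  have e1 : W.X (i + 1 + 1) = W.X (i + 2) := rfl
  have e2 : W.Y (i + 1 + 1) = W.Y (i + 2) := rfl
  rw [e1, e2] at h2
  unfold incFar incNear
  rw [e1, e2]
  generalize W.X (i + 2) = x2 at *
  generalize W.Y (i + 2) = y2 at *
  generalize W.X (i + 1) = x1 at *
  generalize W.Y (i + 1) = y1 at *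
  generalize W.D (i + 1) = d1 at *
  generalize W.D i = d0 at *
  rcases h1 with ⟨a1, rfl, rfl⟩ | ⟨a1, rfl, rfl⟩ | ⟨a1, rfl, rfl⟩ | ⟨a1, rfl, rfl⟩ <;>
  rcases h2 with ⟨a2, rfl, rfl⟩ | ⟨a2, rfl, rfl⟩ | ⟨a2, rfl, rfl⟩ | ⟨a2, rfl, rfl⟩ <;>
  unfold inc oct <;> omega

theorem incNear_square {i j : ℕ} (h : i + 1 < j) (hj : j < W.m) :
    W.incFar i j + W.incNear (j + 1) i = W.incNear j i + W.incFar (i + 1) j := by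
  have b1 := inc_bounds (W.nbr_row (i := i) hj) (W.sub_ne_zero (by omega) (by omega))
    (W.sub_ne_zero (by omega) (by omega))
  have b2 := inc_bounds (W.nbr_row (i := i + 1) hj) (W.sub_ne_zero (by omega) (by omega))
    (W.sub_ne_zero (by omega) (by omega))
  have b3 := inc_bounds (W.nbr_col (i := j) (n := i) (by omega))
    (W.sub_ne_zero (by omega) (by omega)) (W.sub_ne_zero (by omega) (by omega))
  have b4 := inc_bounds (W.nbr_col (i := j + 1) (n := i) (by omega))
    (W.sub_ne_zero (by omega) (by omega)) (W.sub_ne_zero (by omega) (by omega))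
  unfold incFar incNear
  unfold inc at *
  omega

theorem secant_succ_left {i j : ℕ} (h : i + 1 < j) (hj : j ≤ W.m) :
    W.secant (i + 1) j - W.secant i j = W.incNear j i := by
  induction j, h using Nat.le_induction with
  | base =>
    have : W.incFar i (i + 1) + W.incNear (i + 1 + 1) i = 2 * W.D (i + 1) - 2 * W.D i :=
      W.incFar_corner (by omega)
    simp only [secant, Nat.succ_eq_add_one, Finset.Ico_self, Finset.sum_empty,
      Nat.Ico_succ_singleton, Finset.sum_singleton]
    omega
  | succ j hij ih =>
    have ih := ih (by omega)
    have := W.incNear_square (i := i) (j := j) (by omega) (by omega)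
    simp only [secant] at ih ⊢
    rw [Finset.sum_Ico_succ_top (by omega), Finset.sum_Ico_succ_top (by omega)]
    omega

/-- The discrete turning tangent theorem: the total turning of a self-avoiding walk is the sum of
its angular changes as seen from its two ends. -/
theorem total_turning {N : ℕ} (hN : W.m = N + 1) :
    2 * W.D N - 2 * W.D 0 =
      ∑ l ∈ Finset.Ico 1 W.m, W.incFar 0 l + ∑ i ∈ Finset.range N, W.incNear W.m i := by
  have h1 : ∑ i ∈ Finset.range N, W.incNear W.m i = W.secant N W.m - W.secant 0 W.m := by
    rw [← Finset.sum_range_sub (fun i => W.secant i W.m)]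
    refine Finset.sum_congr rfl fun i hi => ?_
    have := Finset.mem_range.1 hi
    exact (W.secant_succ_left (by omega) le_rfl).symm
  rw [h1]
  simp only [secant, hN, zero_add, Finset.Ico_self, Finset.sum_empty]
  ring

/-- Contribution of the `l`-th step to the winding number around the face with lower left corner
`(x, y)`. -/
def windTerm (x y : ℤ) (l : ℕ) : ℤ :=
  (if W.D l % 4 = 1 ∧ x < W.X l ∧ W.Y l = y then 1 else 0) -
    (if W.D l % 4 = 3 ∧ x < W.X l ∧ W.Y l = y + 1 then 1 else 0)

/-- Signed number of upward crossings of the rightward ray from the face with lower left corner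
`(x, y)`. -/
def wind (x y : ℤ) : ℤ := ∑ l ∈ Finset.range W.m, W.windTerm x y l

/-- Contribution of the `l`-th step to the flow through the edge from `(x, y)` to `(x + 1, y)`. -/
def hTerm (x y : ℤ) (l : ℕ) : ℤ :=
  (if W.D l % 4 = 0 ∧ W.X l = x ∧ W.Y l = y then 1 else 0) -
    (if W.D l % 4 = 2 ∧ W.X l = x + 1 ∧ W.Y l = y then 1 else 0)

/-- Contribution of the `l`-th step to the flow through the edge from `(x, y)` to `(x, y + 1)`. -/
def vTerm (x y : ℤ) (l : ℕ) : ℤ :=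
  (if W.D l % 4 = 1 ∧ W.X l = x ∧ W.Y l = y then 1 else 0) -
    (if W.D l % 4 = 3 ∧ W.X l = x ∧ W.Y l = y + 1 then 1 else 0)

/-- Flow of the walk through the edge from `(x, y)` to `(x + 1, y)`. -/
def hFlow (x y : ℤ) : ℤ := ∑ l ∈ Finset.range W.m, W.hTerm x y l

/-- Flow of the walk through the edge from `(x, y)` to `(x, y + 1)`. -/
def vFlow (x y : ℤ) : ℤ := ∑ l ∈ Finset.range W.m, W.vTerm x y l

theorem wind_sub_one_left (x y : ℤ) : W.wind (x - 1) y = W.wind x y + W.vFlow x y := by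
  unfold wind vFlow
  rw [← Finset.sum_add_distrib]
  refine Finset.sum_congr rfl fun l _ => ?_
  unfold windTerm vTerm
  split_ifs <;> omega

theorem wind_sub_one_right (x y : ℤ) :
    W.wind x y = W.wind x (y - 1) + W.hFlow x y -
      ((if x < W.X W.m ∧ W.Y W.m = y then 1 else 0) -
        (if x < W.X 0 ∧ W.Y 0 = y then 1 else 0)) := by
  have h := Finset.sum_range_sub (fun l => if x < W.X l ∧ W.Y l = y then (1 : ℤ) else 0) W.m
  rw [← h]
  unfold wind hFlow
  rw [← Finset.sum_add_distrib, ← Finset.sum_sub_distrib]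
  refine Finset.sum_congr rfl fun l hl => ?_
  have := W.step l (Finset.mem_range.1 hl)
  unfold windTerm hTerm
  generalize W.X (l + 1) = x1 at *
  generalize W.Y (l + 1) = y1 at *
  rcases this with ⟨a1, rfl, rfl⟩ | ⟨a1, rfl, rfl⟩ | ⟨a1, rfl, rfl⟩ | ⟨a1, rfl, rfl⟩ <;>
    simp only [a1] <;> norm_num <;> split_ifs <;> omega

theorem sum_eq_of_support {m p : ℕ} (hp : p + 1 < m) {f : ℕ → ℤ}
    (hf : ∀ l < m, l ≠ p → l ≠ p + 1 → f l = 0) :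
    ∑ l ∈ Finset.range m, f l = f p + f (p + 1) := by
  rw [← Finset.sum_pair (f := f) (show p ≠ p + 1 by omega)]
  refine (Finset.sum_subset ?_ ?_).symm
  · intro x hx
    simp only [Finset.mem_insert, Finset.mem_singleton] at hx
    simp only [Finset.mem_range]; omega
  · intro x hx hx'
    simp only [Finset.mem_insert, Finset.mem_singleton, not_or] at hx'
    exact hf x (Finset.mem_range.1 hx) hx'.1 hx'.2

theorem eq_of_coord_eq {i j : ℕ} (hi : i ≤ W.m) (hj : j ≤ W.m) (hx : W.X i = W.X j)
    (hy : W.Y i = W.Y j) : i = j := by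
  rcases lt_trichotomy i j with h | h | h
  · exact (W.inj i j h hj hx hy).elim
  · exact h
  · exact (W.inj j i h hi hx.symm hy.symm).elim

theorem flow_at {p : ℕ} (hp : p + 1 < W.m) :
    (W.hFlow (W.X (p + 1)) (W.Y (p + 1)) =
      (if W.D (p + 1) % 4 = 0 then 1 else 0) - (if W.D p % 4 = 2 then 1 else 0)) ∧
    (W.hFlow (W.X (p + 1) - 1) (W.Y (p + 1)) =
      (if W.D p % 4 = 0 then 1 else 0) - (if W.D (p + 1) % 4 = 2 then 1 else 0)) ∧
    (W.vFlow (W.X (p + 1)) (W.Y (p + 1)) =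
      (if W.D (p + 1) % 4 = 1 then 1 else 0) - (if W.D p % 4 = 3 then 1 else 0)) ∧
    (W.vFlow (W.X (p + 1)) (W.Y (p + 1) - 1) =
      (if W.D p % 4 = 1 then 1 else 0) - (if W.D (p + 1) % 4 = 3 then 1 else 0)) := by
  have s1 := W.step p (by omega)
  have key : ∀ l < W.m, l ≠ p → l ≠ p + 1 →
      ¬(W.X l = W.X (p + 1) ∧ W.Y l = W.Y (p + 1)) ∧
      ¬(W.X (l + 1) = W.X (p + 1) ∧ W.Y (l + 1) = W.Y (p + 1)) := by
    intro l hl h1 h2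
    constructor
    · rintro ⟨hx, hy⟩
      exact h2 (W.eq_of_coord_eq (by omega) (by omega) hx hy)
    · rintro ⟨hx, hy⟩
      have := W.eq_of_coord_eq (by omega) (by omega) hx hy
      omega
  refine ⟨?_, ?_, ?_, ?_⟩
  all_goals
    first | unfold hFlow | unfold vFlow
    rw [sum_eq_of_support hp]
    · first | unfold hTerm | unfold vTerm
      clear key
      split_ifs <;> omega
    · intro l hl h1 h2
      have k := key l hl h1 h2
      have s2 := W.step l hl
      first | unfold hTerm | unfold vTerm
      rw [if_neg (by omega), if_neg (by omega)]; rfl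

/-- Winding number of the face on the left of the `n`-th step. -/
def label (n : ℕ) : ℤ :=
  if W.D n % 4 = 0 then W.wind (W.X n) (W.Y n)
  else if W.D n % 4 = 1 then W.wind (W.X n - 1) (W.Y n)
  else if W.D n % 4 = 2 then W.wind (W.X n - 1) (W.Y n - 1)
  else W.wind (W.X n) (W.Y n - 1)

theorem label_eq_head {n : ℕ} (hn : n < W.m) : W.label n =
    if W.D n % 4 = 0 then W.wind (W.X (n + 1) - 1) (W.Y (n + 1))
    else if W.D n % 4 = 1 then W.wind (W.X (n + 1) - 1) (W.Y (n + 1) - 1)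
    else if W.D n % 4 = 2 then W.wind (W.X (n + 1)) (W.Y (n + 1) - 1)
    else W.wind (W.X (n + 1)) (W.Y (n + 1)) := by
  unfold label
  rcases W.step n hn with ⟨a1, hx, hy⟩ | ⟨a1, hx, hy⟩ | ⟨a1, hx, hy⟩ | ⟨a1, hx, hy⟩ <;>
    simp [a1, hx, hy]

end LatticeWalk

/-- A lattice walk from the origin to `(a, 0)` whose first and last steps point east, the total
turning being `k` full turns. -/
structure AxisWalk extends LatticeWalk where
  a : ℤ
  k : ℤ
  N : ℕ
  a_pos : 0 < a
  N_pos : 0 < N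
  m_eq : m = N + 1
  X_zero : X 0 = 0
  Y_zero : Y 0 = 0
  X_last : X m = a
  Y_last : Y m = 0
  D_zero : D 0 = 0
  D_last : D N = 4 * k

namespace AxisWalk

variable (W : AxisWalk)

/-- The `n`-th vertex lies on the open segment from the origin to the endpoint. -/
def OnSlit (n : ℕ) : Prop := W.Y n = 0 ∧ 0 < W.X n ∧ W.X n < W.a

instance (n : ℕ) : Decidable (W.OnSlit n) := inferInstanceAs (Decidable (_ ∧ _ ∧ _))

/-- Change of the left label of the walk when it passes its vertex `p + 1`. -/
def jump (p : ℕ) : ℤ :=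
  if W.OnSlit (p + 1) then
    (if W.D p % 4 = 3 ∧ (W.D (p + 1) % 4 = 3 ∨ W.D (p + 1) % 4 = 2) ∨
        W.D p % 4 = 0 ∧ W.D (p + 1) % 4 = 3 then 1 else 0) -
      (if W.D p % 4 = 1 ∧ (W.D (p + 1) % 4 = 1 ∨ W.D (p + 1) % 4 = 0) ∨
        W.D p % 4 = 2 ∧ W.D (p + 1) % 4 = 1 then 1 else 0)
  else 0

theorem ne_origin {n : ℕ} (h : 0 < n) (hn : n ≤ W.m) : ¬(W.X n = 0 ∧ W.Y n = 0) := fun h' =>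
  W.inj 0 n h hn (by rw [W.X_zero, h'.1]) (by rw [W.Y_zero, h'.2])

theorem ne_endpoint {n : ℕ} (hn : n < W.m) : ¬(W.X n = W.a ∧ W.Y n = 0) := fun h' =>
  W.inj n W.m hn le_rfl (by rw [W.X_last, h'.1]) (by rw [W.Y_last, h'.2])

theorem wind_below (x y : ℤ) :
    W.wind x y = W.wind x (y - 1) + W.hFlow x y - (if y = 0 ∧ 0 ≤ x ∧ x < W.a then 1 else 0) := by
  have := W.wind_sub_one_right x y
  have := W.a_pos
  rw [W.X_zero, W.Y_zero, W.X_last, W.Y_last] at *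
  split_ifs at * <;> omega

theorem label_succ {p : ℕ} (hp : p + 1 < W.m) : W.label (p + 1) = W.label p + W.jump p := by
  have h1 := W.label_eq_head (n := p) (by omega)
  obtain ⟨f1, f2, f3, f4⟩ := W.flow_at hp
  have w1 := W.wind_sub_one_left (W.X (p + 1)) (W.Y (p + 1))
  have w2 := W.wind_sub_one_left (W.X (p + 1)) (W.Y (p + 1) - 1)
  have w3 := W.wind_below (W.X (p + 1)) (W.Y (p + 1))
  have w4 := W.wind_below (W.X (p + 1) - 1) (W.Y (p + 1))
  have t := W.turn p hp
  have o1 := W.ne_origin (n := p + 1) (by omega) (by omega)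
  have o2 := W.ne_endpoint hp
  have ha := W.a_pos
  rw [f3] at w1
  rw [f4] at w2
  rw [f1] at w3
  rw [f2] at w4
  rw [h1]
  unfold LatticeWalk.label jump OnSlit
  clear f1 f2 f3 f4 h1
  generalize W.wind (W.X (p + 1)) (W.Y (p + 1)) = ne at *
  generalize W.wind (W.X (p + 1) - 1) (W.Y (p + 1)) = nw at *
  generalize W.wind (W.X (p + 1)) (W.Y (p + 1) - 1) = se at *
  generalize W.wind (W.X (p + 1) - 1) (W.Y (p + 1) - 1) = sw at *
  have d0 : W.D p % 4 = 0 ∨ W.D p % 4 = 1 ∨ W.D p % 4 = 2 ∨ W.D p % 4 = 3 := by omega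
  have d1 : W.D (p + 1) % 4 = 0 ∨ W.D (p + 1) % 4 = 1 ∨ W.D (p + 1) % 4 = 2 ∨
      W.D (p + 1) % 4 = 3 := by omega
  rcases d0 with h | h | h | h <;> rcases d1 with h' | h' | h' | h' <;>
    first
    | (exfalso; clear w1 w2 w3 w4; omega)
    | ((simp only [h, h'] at w1 w2 w3 w4 ⊢; norm_num at w1 w2 w3 w4 ⊢) <;> split_ifs at * <;> omega)

theorem sum_incFar : ∑ l ∈ Finset.Ico 1 W.m, W.incFar 0 l = 8 * W.wind 0 (-1) := by
  have hm := W.m_eq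
  have hN := W.N_pos
  have e : ∑ l ∈ Finset.Ico 1 W.m, W.incFar 0 l = ∑ l ∈ Finset.Ico 1 W.m,
      ((LatticeWalk.oct (W.X (l + 1)) (W.Y (l + 1)) - LatticeWalk.oct (W.X l) (W.Y l)) +
        8 * W.windTerm 0 (-1) l) := by
    refine Finset.sum_congr rfl fun l hl => ?_
    obtain ⟨h1, h2⟩ := Finset.mem_Ico.1 hl
    have s := W.step l h2
    unfold LatticeWalk.incFar
    rw [LatticeWalk.inc_eq_oct_sub (W.nbr_row (i := 0) h2) (W.sub_ne_zero (by omega) (by omega))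
      (W.sub_ne_zero (by omega) (by omega))]
    simp only [W.X_zero, W.Y_zero, sub_zero]
    unfold LatticeWalk.windTerm
    congr 2
    congr 1 <;> split_ifs <;> omega
  have s0 : W.windTerm 0 (-1) 0 = 0 := by
    simp [LatticeWalk.windTerm, W.X_zero]
  have s1 := W.step 0 (by omega)
  simp only [zero_add] at s1
  have d0 := W.D_zero
  have x0 := W.X_zero
  have y0 := W.Y_zero
  have o1 : LatticeWalk.oct (W.X 1) (W.Y 1) = 0 := by
    rw [show W.X 1 = 1 by omega, show W.Y 1 = 0 by omega]; simp [LatticeWalk.oct]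
  have o2 : LatticeWalk.oct (W.X W.m) (W.Y W.m) = 0 := by
    rw [W.X_last, W.Y_last]; simp [LatticeWalk.oct, W.a_pos]
  rw [e, Finset.sum_add_distrib, ← Finset.mul_sum,
    Finset.sum_Ico_sub (fun l => LatticeWalk.oct (W.X l) (W.Y l)) (by omega), o1, o2]
  unfold LatticeWalk.wind
  rw [Finset.range_eq_Ico, Finset.sum_eq_sum_Ico_succ_bot (show 0 < W.m by omega), s0]
  ring

theorem sum_incNear : ∑ i ∈ Finset.range W.N, W.incNear W.m i = 8 * W.wind (W.a - 1) 0 := by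
  have hm := W.m_eq
  have dN := W.D_last
  have sN := W.step W.N (by omega)
  have xm := W.X_last
  have ym := W.Y_last
  rw [← hm] at sN
  have e : ∑ i ∈ Finset.range W.N, W.incNear W.m i = ∑ i ∈ Finset.range W.N,
      ((LatticeWalk.oct (W.a - W.X (i + 1)) (-W.Y (i + 1)) -
          LatticeWalk.oct (W.a - W.X i) (-W.Y i)) +
        8 * (W.windTerm (W.a - 1) 0 i -
          ((if 0 < W.Y (i + 1) then 1 else 0) - (if 0 < W.Y i then 1 else 0)))) := by
    refine Finset.sum_congr rfl fun i hi => ?_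
    have hi := Finset.mem_range.1 hi
    have s := W.step i (by omega)
    have e1 := W.ne_endpoint (n := i) (by omega)
    have e2 := W.ne_endpoint (n := i + 1) (by omega)
    unfold LatticeWalk.incNear
    rw [LatticeWalk.inc_eq_oct_sub (W.nbr_col (i := W.m) (by omega))
      (W.sub_ne_zero (by omega) (by omega)) (W.sub_ne_zero (by omega) (by omega))]
    simp only [xm, ym, zero_sub]
    unfold LatticeWalk.windTerm
    congr 2
    split_ifs <;> omega
  have o1 : LatticeWalk.oct (W.a - W.X W.N) (-W.Y W.N) = 0 := by
    rw [show W.a - W.X W.N = 1 by omega, show -W.Y W.N = 0 by omega]; simp [LatticeWalk.oct]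
  have o2 : LatticeWalk.oct (W.a - W.X 0) (-W.Y 0) = 0 := by
    rw [W.X_zero, W.Y_zero]; simp [LatticeWalk.oct, W.a_pos]
  have last : W.windTerm (W.a - 1) 0 W.N = 0 := by
    unfold LatticeWalk.windTerm
    rw [if_neg (by omega), if_neg (by omega)]; rfl
  rw [e, Finset.sum_add_distrib, ← Finset.mul_sum,
    Finset.sum_range_sub (fun i => LatticeWalk.oct (W.a - W.X i) (-W.Y i)),
    Finset.sum_sub_distrib,
    Finset.sum_range_sub (fun i => if 0 < W.Y i then (1 : ℤ) else 0), o1, o2,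
    W.Y_zero, show W.Y W.N = 0 by omega]
  unfold LatticeWalk.wind
  rw [hm, Finset.sum_range_succ, last]
  simp

theorem label_zero : W.label 0 = W.wind 0 (-1) := by
  have hm := W.m_eq
  have hN := W.N_pos
  have s := W.step 0 (by omega)
  simp only [zero_add] at s
  have d0 := W.D_zero
  have x0 := W.X_zero
  have y0 := W.Y_zero
  have t := W.turn 0 (by omega)
  have f := (W.flow_at (p := 0) (by omega)).2.1
  have w := W.wind_below 0 0
  rw [show 0 + 1 = 1 from rfl] at *
  rw [show W.X 1 - 1 = 0 by omega, show W.Y 1 = 0 by omega, if_pos (by omega),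
    if_neg (by omega)] at f
  rw [f, if_pos ⟨rfl, le_rfl, W.a_pos⟩] at w
  unfold LatticeWalk.label
  rw [if_pos (by omega), x0, y0, w]
  norm_num

theorem label_last : W.label W.N = W.wind (W.a - 1) 0 := by
  have hm := W.m_eq
  have dN := W.D_last
  have h := W.label_eq_head (n := W.N) (by omega)
  rw [if_pos (by omega), ← hm, W.X_last, W.Y_last] at h
  exact h

theorem label_zero_add_label_last : W.label 0 + W.label W.N = W.k := by
  have h := W.total_turning W.m_eq
  rw [W.sum_incFar, W.sum_incNear, W.D_last, W.D_zero] at h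
  rw [label_zero, label_last]
  omega

/-- The walk dips below the axis unless it has total turning zero; the first lowest vertex is
followed by a horizontal step whose left label is at most one. -/
theorem exists_low (hk : W.k ≠ 0) :
    ∃ j, 0 < j ∧ j < W.N ∧ W.Y j < 0 ∧ W.label j ≤ 1 := by
  have hm := W.m_eq
  have hneg : ∃ n ≤ W.m, W.Y n < 0 := by
    by_contra! hcon
    have z : ∀ x, W.wind x (-1) = 0 := by
      intro x
      refine Finset.sum_eq_zero fun l hl => ?_
      have hl := Finset.mem_range.1 hl
      have s := W.step l hl
      have c1 := hcon l (by omega)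
      have c2 := hcon (l + 1) (by omega)
      unfold LatticeWalk.windTerm
      rw [if_neg (by omega), if_neg (by omega)]; rfl
    have h := W.label_zero_add_label_last
    have hN := W.N_pos
    have sN := W.step W.N (by omega)
    have dN := W.D_last
    have xm := W.X_last
    have ym := W.Y_last
    have ha := W.a_pos
    have t := W.turn (W.N - 1) (by omega)
    have f := (W.flow_at (p := W.N - 1) (by omega)).1
    rw [show W.N - 1 + 1 = W.N by omega] at *
    rw [hm] at xm ym
    rw [if_pos (by omega), if_neg (by omega), show W.X W.N = W.a - 1 by omega,
      show W.Y W.N = 0 by omega] at f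
    have w := W.wind_below (W.a - 1) 0
    rw [f, if_pos (by omega), show (0 : ℤ) - 1 = -1 from rfl, z] at w
    rw [label_zero, label_last, w, z] at h
    omega
  obtain ⟨n₀, hn₀, hY₀⟩ := hneg
  obtain ⟨n₁, hn₁, hmin⟩ := Finset.exists_min_image (Finset.range (W.m + 1)) W.Y ⟨0, by simp⟩
  have hex : ∃ n, n ≤ W.m ∧ W.Y n = W.Y n₁ := ⟨n₁, by simpa [Nat.lt_succ_iff] using hn₁, rfl⟩
  have hlow : ∀ n ≤ W.m, W.Y n₁ ≤ W.Y n := fun n hn => hmin n (by simp; omega)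
  obtain ⟨hj1, hj2⟩ := Nat.find_spec hex
  have hfirst := fun n => Nat.find_min hex (m := n)
  generalize Nat.find hex = j at *
  have hY : W.Y n₁ < 0 := by have := hlow n₀ hn₀; omega
  have j0 : j ≠ 0 := by
    rintro rfl
    have := W.Y_zero
    omega
  have jm : j ≠ W.m := by
    rintro rfl
    have := W.Y_last
    omega
  obtain ⟨i, rfl⟩ : ∃ i, j = i + 1 := ⟨j - 1, by omega⟩
  have s1 := W.step i (by omega)
  have s2 := W.step (i + 1) (by omega)
  have t := W.turn i (by omega)
  have c1 := hlow i (by omega)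
  have c2 := hlow (i + 1 + 1) (by omega)
  have c3 := hfirst i (by omega)
  have jN : i + 1 ≠ W.N := by
    intro h
    have := W.Y_last
    have := W.D_last
    rw [hm, ← h] at *
    omega
  refine ⟨i + 1, by omega, by omega, by omega, ?_⟩
  have zero : W.wind (W.X (i + 1)) (W.Y (i + 1) - 1) = 0 ∧
      W.wind (W.X (i + 1) - 1) (W.Y (i + 1) - 1) = 0 := by
    constructor <;>
    · refine Finset.sum_eq_zero fun l hl => ?_
      have hl := Finset.mem_range.1 hl
      have s := W.step l hl
      have c1 := hlow l (by omega)
      have c2 := hlow (l + 1) (by omega)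
      unfold LatticeWalk.windTerm
      rw [if_neg (by omega), if_neg (by omega)]; rfl
  have w := W.wind_below (W.X (i + 1)) (W.Y (i + 1))
  rw [zero.1, (W.flow_at (p := i) (by omega)).1] at w
  unfold LatticeWalk.label
  rw [zero.1, zero.2]
  split_ifs at * <;> omega

theorem label_eq_add_sum {i j : ℕ} (hij : i ≤ j) (hj : j ≤ W.N) :
    W.label j = W.label i + ∑ p ∈ Finset.Ico i j, W.jump p := by
  induction j, hij using Nat.le_induction with
  | base => simp
  | succ j hij ih =>
    have hm := W.m_eq
    rw [Finset.sum_Ico_succ_top hij, W.label_succ (by omega), ih (by omega)]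
    ring

theorem jump_bounds (p : ℕ) : -1 ≤ W.jump p ∧ W.jump p ≤ 1 := by
  unfold jump
  split_ifs <;> omega

/-- The label change at vertex `p + 1`, counted in the direction leading away from step `j`. -/
def gain (j p : ℕ) : ℤ := if p < j then -W.jump p else W.jump p

theorem gain_le_one (j p : ℕ) : W.gain j p ≤ 1 := by
  have := W.jump_bounds p
  unfold gain
  split_ifs <;> omega

/-- The indices `p` for which vertex `p + 1` lies on the slit. -/
def slit : Finset ℕ := (Finset.range W.N).filter fun p => W.OnSlit (p + 1)

theorem mem_slit {p : ℕ} : p ∈ W.slit ↔ p < W.N ∧ W.OnSlit (p + 1) := by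
  simp [slit]

theorem image_slit_subset : W.slit.image (fun p => W.X (p + 1)) ⊆ Finset.Ioo 0 W.a := by
  intro x hx
  obtain ⟨p, hp, rfl⟩ := Finset.mem_image.1 hx
  have := (W.mem_slit.1 hp).2
  exact Finset.mem_Ioo.2 this.2

theorem card_image_slit : (W.slit.image (fun p => W.X (p + 1))).card = W.slit.card := by
  refine Finset.card_image_of_injOn fun p hp q hq h => ?_
  have hm := W.m_eq
  have hp := W.mem_slit.1 hp
  have hq := W.mem_slit.1 hq
  have := W.eq_of_coord_eq (i := p + 1) (j := q + 1) (by omega) (by omega) h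
    (by rw [hp.2.1, hq.2.1])
  omega

theorem card_slit_le : (W.slit.card : ℤ) ≤ W.a - 1 := by
  have h := Finset.card_le_card W.image_slit_subset
  have ha := W.a_pos
  rw [card_image_slit, Int.card_Ioo] at h
  omega

theorem k_add_deficit_le {j : ℕ} (hj : j ≤ W.N) (hlab : W.label j ≤ 1) {U : Finset ℕ}
    (hU : U ⊆ W.slit) : W.k + ∑ p ∈ U, (1 - W.gain j p) ≤ 2 + W.slit.card := by
  have h1 := W.label_zero_add_label_last
  have h2 := W.label_eq_add_sum (Nat.zero_le j) hj
  have h3 := W.label_eq_add_sum hj le_rfl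
  have h4 : ∑ p ∈ Finset.range W.N, W.gain j p =
      -∑ p ∈ Finset.Ico 0 j, W.jump p + ∑ p ∈ Finset.Ico j W.N, W.jump p := by
    rw [Finset.range_eq_Ico, ← Finset.sum_Ico_consecutive _ (Nat.zero_le j) hj,
      ← Finset.sum_neg_distrib]
    congr 1 <;> refine Finset.sum_congr rfl fun p hp => ?_
    · exact if_pos (Finset.mem_Ico.1 hp).2
    · exact if_neg (not_lt.2 (Finset.mem_Ico.1 hp).1)
  have h5 : ∑ p ∈ W.slit, W.gain j p = ∑ p ∈ Finset.range W.N, W.gain j p := by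
    refine Finset.sum_subset (Finset.filter_subset _ _) fun p hp hp' => ?_
    have : ¬W.OnSlit (p + 1) := fun h => hp' (W.mem_slit.2 ⟨Finset.mem_range.1 hp, h⟩)
    simp [gain, jump, this]
  have h6 : ∑ p ∈ U, (1 - W.gain j p) ≤ ∑ p ∈ W.slit, (1 - W.gain j p) :=
    Finset.sum_le_sum_of_subset_of_nonneg hU fun p _ _ => by
      have := W.gain_le_one j p
      omega
  have h7 : ∑ p ∈ W.slit, (1 - W.gain j p) = W.slit.card - ∑ p ∈ W.slit, W.gain j p := by
    simp [Finset.sum_sub_distrib]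
  omega

/-- The first turn of the walk happens at vertex `t`. -/
def FirstTurn (t : ℕ) : Prop := 0 < t ∧ t ≤ W.N ∧ (∀ n < t, W.D n = 0) ∧ W.D t ≠ 0

/-- The last turn of the walk happens at vertex `s`. -/
def LastTurn (s : ℕ) : Prop :=
  0 < s ∧ s ≤ W.N ∧ (∀ n, s ≤ n → n ≤ W.N → W.D n = 4 * W.k) ∧ W.D (s - 1) ≠ 4 * W.k

variable {W}

theorem FirstTurn.pos {t : ℕ} (ht : W.FirstTurn t) {n : ℕ} (hn : n ≤ t) :
    W.X n = n ∧ W.Y n = 0 := by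
  induction n with
  | zero => exact ⟨W.X_zero, W.Y_zero⟩
  | succ n ih =>
    have hm := W.m_eq
    have := ih (by omega)
    have := ht.2.2.1 n (by omega)
    have := ht.2.1
    have := W.step n (by omega)
    omega

theorem LastTurn.pos {s : ℕ} (hs : W.LastTurn s) {n : ℕ} (hn : n ≤ W.m - s) :
    W.X (W.m - n) = W.a - n ∧ W.Y (W.m - n) = 0 := by
  induction n with
  | zero =>
    have := W.X_last
    have := W.Y_last
    simpa using ⟨W.X_last, W.Y_last⟩
  | succ n ih =>
    have hm := W.m_eq
    have h1 := ih (by omega)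
    have h2 := hs.2.2.1 (W.m - (n + 1)) (by omega) (by omega)
    have h3 := W.step (W.m - (n + 1)) (by omega)
    rw [show W.m - (n + 1) + 1 = W.m - n by omega] at h3
    omega

theorem FirstTurn.dir {t : ℕ} (ht : W.FirstTurn t) : W.D t = 1 ∨ W.D t = -1 := by
  obtain ⟨h1, h2, h3, h4⟩ := ht
  have hm := W.m_eq
  have h5 := W.turn (t - 1) (by omega)
  have h6 := h3 (t - 1) (by omega)
  rw [show t - 1 + 1 = t by omega] at h5
  omega

theorem LastTurn.dir {s : ℕ} (hs : W.LastTurn s) :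
    W.D (s - 1) = 4 * W.k - 1 ∨ W.D (s - 1) = 4 * W.k + 1 := by
  obtain ⟨h1, h2, h3, h4⟩ := hs
  have hm := W.m_eq
  have h5 := W.turn (s - 1) (by omega)
  have h6 := h3 s le_rfl h2
  rw [show s - 1 + 1 = s by omega] at h5
  omega

theorem FirstTurn.onSlit {t : ℕ} (ht : W.FirstTurn t) : W.OnSlit t := by
  have hm := W.m_eq
  have h1 := ht.pos le_rfl
  have h2 := ht.1
  have h3 := ht.2.1
  refine ⟨h1.2, by omega, ?_⟩
  by_contra! hcon
  have ha := W.a_pos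
  have h4 := ht.pos (n := W.a.toNat) (by omega)
  exact W.ne_endpoint (n := W.a.toNat) (by omega) ⟨by omega, h4.2⟩

theorem LastTurn.onSlit {s : ℕ} (hs : W.LastTurn s) : W.OnSlit s := by
  have hm := W.m_eq
  have h2 := hs.1
  have h3 := hs.2.1
  have h1 := hs.pos (n := W.m - s) le_rfl
  rw [show W.m - (W.m - s) = s by omega] at h1
  refine ⟨h1.2, ?_, by omega⟩
  by_contra! hcon
  have ha := W.a_pos
  have h4 := hs.pos (n := W.a.toNat) (by omega)
  exact W.ne_origin (n := W.m - W.a.toNat) (by omega) (by omega) ⟨by omega, h4.2⟩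

theorem FirstTurn.lt_of_neg {t j : ℕ} (ht : W.FirstTurn t) (hY : W.Y j < 0) : t < j := by
  by_contra! h
  have := ht.pos h
  omega

theorem LastTurn.gt_of_neg {s j : ℕ} (hs : W.LastTurn s) (hj : j ≤ W.m) (hY : W.Y j < 0) :
    j < s := by
  by_contra! h
  have := hs.pos (n := W.m - j) (by omega)
  rw [show W.m - (W.m - j) = j by omega] at this
  omega

theorem FirstTurn.gain {t j : ℕ} (ht : W.FirstTurn t) (hj : t < j) :
    W.gain j (t - 1) = if W.D t = -1 then -1 else 0 := by
  have h1 := ht.1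
  have h2 := ht.2.2.1 (t - 1) (by omega)
  have h3 := ht.dir
  unfold AxisWalk.gain jump
  rw [show t - 1 + 1 = t by omega, if_pos (by omega), if_pos ht.onSlit]
  split_ifs <;> omega

theorem LastTurn.gain_le {s j : ℕ} (hs : W.LastTurn s) (hj : j < s) :
    W.gain j (s - 1) ≤ 0 := by
  have h1 := hs.1
  have h2 := hs.2.2.1 s le_rfl hs.2.1
  have h3 := hs.dir
  unfold AxisWalk.gain jump
  rw [show s - 1 + 1 = s by omega, if_neg (by omega), if_pos hs.onSlit]
  split_ifs <;> omega

theorem FirstTurn.mem_slit {t : ℕ} (ht : W.FirstTurn t) : t - 1 ∈ W.slit := by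
  have h1 := ht.1
  have h2 := ht.2.1
  exact W.mem_slit.2 ⟨by omega, by rw [show t - 1 + 1 = t by omega]; exact ht.onSlit⟩

theorem LastTurn.mem_slit {s : ℕ} (hs : W.LastTurn s) : s - 1 ∈ W.slit := by
  have h1 := hs.1
  have h2 := hs.2.1
  exact W.mem_slit.2 ⟨by omega, by rw [show s - 1 + 1 = s by omega]; exact hs.onSlit⟩

theorem k_add_two_le_of_gain {t s j : ℕ} (ht : W.FirstTurn t) (hs : W.LastTurn s) (hj : j ≤ W.N)
    (hY : W.Y j < 0) (hlab : W.label j ≤ 1) :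
    W.k + (if W.D t = -1 then 1 else 0) ≤ W.slit.card := by
  have htj := ht.lt_of_neg hY
  have hm := W.m_eq
  have hjs := hs.gt_of_neg (by omega) hY
  have h := W.k_add_deficit_le hj hlab (U := {t - 1, s - 1})
    (by simp [Finset.insert_subset_iff, ht.mem_slit, hs.mem_slit])
  have ht1 := ht.1
  rw [Finset.sum_pair (by omega), ht.gain htj] at h
  have := hs.gain_le hjs
  split_ifs at * <;> omega

theorem k_add_one_le {t s : ℕ} (ht : W.FirstTurn t) (hs : W.LastTurn s) (hk : W.k ≠ 0) :
    W.k + 1 ≤ W.a := by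
  obtain ⟨j, -, hj, hY, hlab⟩ := W.exists_low hk
  have h1 := k_add_two_le_of_gain ht hs hj.le hY hlab
  have h2 := W.card_slit_le
  split_ifs at * <;> omega

theorem k_add_two_le_of_right {t s : ℕ} (ht : W.FirstTurn t) (hs : W.LastTurn s) (hk : W.k ≠ 0)
    (hD : W.D t = -1) : W.k + 2 ≤ W.a := by
  obtain ⟨j, -, hj, hY, hlab⟩ := W.exists_low hk
  have h1 := k_add_two_le_of_gain ht hs hj.le hY hlab
  have h2 := W.card_slit_le
  rw [if_pos hD] at h1
  omega

end AxisWalk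

namespace LatticeWalk

variable (W : LatticeWalk)

/-- The vertex with index `i` is `(x, y)`. -/
def At (i x y : ℤ) : Prop := ∃ n : ℕ, (n : ℤ) = i ∧ n ≤ W.m ∧ W.X n = x ∧ W.Y n = y

/-- A vertical run from `(x, 0)` (with index `q`) up to `(x, h)`, traversed forwards (`σ = 1`) or
backwards (`σ = -1`), followed by the vertex `(x + δ, h)`. -/
def Strand (x q σ h δ : ℤ) : Prop :=
  1 ≤ h ∧ (∀ y, 0 ≤ y → y ≤ h → W.At (q + σ * y) x y) ∧ W.At (q + σ * (h + 1)) (x + δ) h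

variable {W}

theorem At.index_eq {i i' x y : ℤ} (h : W.At i x y) (h' : W.At i' x y) : i = i' := by
  obtain ⟨n, rfl, hn, hx, hy⟩ := h
  obtain ⟨n', rfl, hn', hx', hy'⟩ := h'
  rw [W.eq_of_coord_eq hn hn' (by omega) (by omega)]

theorem At.coord_eq {i i' x y x' y' : ℤ} (h : W.At i x y) (h' : W.At i' x' y') (e : i = i') :
    x = x' ∧ y = y' := by
  obtain ⟨n, rfl, hn, rfl, rfl⟩ := h
  obtain ⟨n', hi, hn', rfl, rfl⟩ := h'
  obtain rfl : n' = n := by omega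
  exact ⟨rfl, rfl⟩

theorem Strand.height_le {x q σ h δ q' σ' h' : ℤ} (hσ : σ = 1 ∨ σ = -1)
    (hσ' : σ' = 1 ∨ σ' = -1) (s : W.Strand x q σ h δ) (s' : W.Strand (x + δ) q' σ' h' (-δ)) :
    h' ≤ h := by
  by_contra! hlt
  obtain ⟨h1, run, last⟩ := s
  obtain ⟨-, run', -⟩ := s'
  have e := last.index_eq (run' h (by omega) (by omega))
  have a := run h (by omega) le_rfl
  have b := run' (h + 1) (by omega) (by omega)
  have c := run' (h - 1) (by omega) (by omega)
  have ab := a.coord_eq b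
  have ac := a.coord_eq c
  rcases hσ with rfl | rfl <;> rcases hσ' with rfl | rfl <;> omega

theorem strand_up {q r : ℕ} {δ : ℤ} (hqr : q < r) (hr : r < W.m) (hY : W.Y q = 0)
    (run : ∀ n, q ≤ n → n < r → W.D n % 4 = 1)
    (hδ : W.D r % 4 = 0 ∧ δ = 1 ∨ W.D r % 4 = 2 ∧ δ = -1) :
    W.Strand (W.X q) q 1 (r - q) δ := by
  have pos : ∀ n, q ≤ n → n ≤ r → W.X n = W.X q ∧ W.Y n = n - q := by
    intro n hn
    induction n, hn using Nat.le_induction with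
    | base => intro; exact ⟨rfl, by omega⟩
    | succ n hn ih =>
      intro h
      have := ih (by omega)
      have := run n hn (by omega)
      have := W.step n (by omega)
      omega
  have sr := W.step r hr
  have pr := pos r hqr.le le_rfl
  refine ⟨by omega, fun y h0 hy => ⟨(q + y).toNat, by omega, by omega, ?_⟩,
    ⟨r + 1, by omega, hr, by omega, by omega⟩⟩
  have := pos (q + y).toNat (by omega) (by omega)
  exact ⟨this.1, by omega⟩

theorem strand_down {q r : ℕ} {δ : ℤ} (hqr : r + 1 < q) (hq : q ≤ W.m) (hY : W.Y q = 0)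
    (run : ∀ n, r < n → n < q → W.D n % 4 = 3)
    (hδ : W.D r % 4 = 2 ∧ δ = 1 ∨ W.D r % 4 = 0 ∧ δ = -1) :
    W.Strand (W.X q) q (-1) (q - (r + 1)) δ := by
  have pos : ∀ i, i + r + 1 ≤ q → W.X (q - i) = W.X q ∧ W.Y (q - i) = i := by
    intro i
    induction i with
    | zero => intro; exact ⟨rfl, by simpa using hY⟩
    | succ i ih =>
      intro h
      have h1 := ih (by omega)
      have h2 := run (q - (i + 1)) (by omega) (by omega)
      have h3 := W.step (q - (i + 1)) (by omega)
      rw [show q - (i + 1) + 1 = q - i by omega] at h3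
      omega
  have sr := W.step r (by omega)
  have pr := pos (q - (r + 1)) (by omega)
  rw [show q - (q - (r + 1)) = r + 1 by omega] at pr
  refine ⟨by omega, fun y h0 hy => ⟨q - y.toNat, by omega, by omega, ?_⟩,
    ⟨r, by omega, by omega, by omega, by omega⟩⟩
  have := pos y.toNat (by omega)
  exact ⟨this.1, by omega⟩

end LatticeWalk

namespace AxisWalk

variable {W : AxisWalk}

/-- Column `x` carries a strand turning in direction `δ`, ascending if it starts no later than
step `j` and descending otherwise. -/
def Col (W : AxisWalk) (j : ℕ) (x δ : ℤ) : Prop :=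
  ∃ q σ h : ℤ, W.Strand x q σ h δ ∧ (σ = 1 ∧ q ≤ j ∨ σ = -1 ∧ j < q)

theorem Col.not_facing {j : ℕ} {x : ℤ} (hY : W.Y j < 0) (c : W.Col j x 1)
    (c' : W.Col j (x + 1) (-1)) : False := by
  obtain ⟨q, σ, h, s, hs⟩ := c
  obtain ⟨q', σ', h', s', hs'⟩ := c'
  have e1 := s.height_le (by omega) (by omega) s'
  have s2 : W.Strand (x + 1 + -1) q σ h (- -1) := by simpa using s
  have e2 := s'.height_le (by omega) (by omega) s2
  obtain rfl : h = h' := le_antisymm e2 e1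
  obtain ⟨h1, run, last⟩ := s
  obtain ⟨-, run', last'⟩ := s'
  have i1 := last.index_eq (run' h (by omega) le_rfl)
  have i2 := (run h (by omega) le_rfl).index_eq (by simpa using last')
  have pos : ∀ {i y : ℤ} {x : ℤ}, W.At i x y → 0 ≤ y → i = j → False := by
    rintro i y x ⟨n, rfl, -, -, rfl⟩ hy e
    obtain rfl : n = j := by exact_mod_cast e
    omega
  rcases hs with ⟨rfl, hq⟩ | ⟨rfl, hq⟩ <;> rcases hs' with ⟨rfl, hq'⟩ | ⟨rfl, hq'⟩ <;> try omega
  · by_cases hc : (j : ℤ) ≤ q + h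
    · exact pos (run (j - q) (by omega) (by omega)) (by omega) (by omega)
    · exact pos (run' (q' - j) (by omega) (by omega)) (by omega) (by omega)
  · by_cases hc : (j : ℤ) ≤ q' + h
    · exact pos (run' (j - q') (by omega) (by omega)) (by omega) (by omega)
    · exact pos (run (q - j) (by omega) (by omega)) (by omega) (by omega)

theorem col_of_up {q j : ℕ} (hq : q < W.N) (hY : W.Y q = 0) (hD : W.D q % 4 = 1) (hj : q ≤ j) :
    W.Col j (W.X q) 1 ∨ W.Col j (W.X q) (-1) := by
  have hm := W.m_eq
  have dN := W.D_last
  have hex : ∃ n, q < n ∧ W.D n % 4 ≠ 1 := ⟨W.N, hq, by omega⟩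
  obtain ⟨h1, h2⟩ := Nat.find_spec hex
  have h3 : ∀ n, q ≤ n → n < Nat.find hex → W.D n % 4 = 1 := by
    intro n hn hn'
    have := Nat.find_min hex hn'
    rcases hn.eq_or_lt with rfl | h
    · exact hD
    · by_contra hc; exact this ⟨h, hc⟩
  have h4 : Nat.find hex ≤ W.N := Nat.find_min' hex ⟨hq, by omega⟩
  generalize Nat.find hex = r at *
  have h5 := W.turn (r - 1) (by omega)
  have h6 := h3 (r - 1) (by omega) (by omega)
  rw [show r - 1 + 1 = r by omega] at h5
  rcases (show W.D r % 4 = 0 ∨ W.D r % 4 = 2 by omega) with h | h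
  · exact .inl ⟨q, 1, _, LatticeWalk.strand_up h1 (by omega) hY h3 (by omega), by omega⟩
  · exact .inr ⟨q, 1, _, LatticeWalk.strand_up h1 (by omega) hY h3 (by omega), by omega⟩

theorem col_of_down {q j : ℕ} (hq : q < W.N) (hY : W.Y (q + 1) = 0) (hD : W.D q % 4 = 3)
    (hj : j ≤ q) : W.Col j (W.X (q + 1)) 1 ∨ W.Col j (W.X (q + 1)) (-1) := by
  have hm := W.m_eq
  have d0 := W.D_zero
  have hq0 : 0 < q := by
    rcases Nat.eq_zero_or_pos q with rfl | h
    · omega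
    · exact h
  have h0 : W.D 0 % 4 ≠ 3 := by omega
  have h1 := Nat.findGreatest_spec (P := fun n => W.D n % 4 ≠ 3) (Nat.zero_le q) h0
  have h2 : ∀ n, Nat.findGreatest (fun n => W.D n % 4 ≠ 3) q < n → n < q + 1 → W.D n % 4 = 3 := by
    intro n hn hn'
    by_contra hc
    exact Nat.findGreatest_is_greatest hn (by omega) hc
  have h3 := Nat.findGreatest_le (P := fun n => W.D n % 4 ≠ 3) q
  generalize Nat.findGreatest (fun n => W.D n % 4 ≠ 3) q = r at *
  have hrq : r ≠ q := by rintro rfl; exact h1 hD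
  have h5 := W.turn r (by omega)
  have h6 := h2 (r + 1) (by omega) (by omega)
  rcases (show W.D r % 4 = 2 ∨ W.D r % 4 = 0 by omega) with h | h
  · exact .inl ⟨_, -1, _, LatticeWalk.strand_down (by omega) (by omega) hY h2 (by omega),
      by omega⟩
  · exact .inr ⟨_, -1, _, LatticeWalk.strand_down (by omega) (by omega) hY h2 (by omega),
      by omega⟩

theorem LastTurn.X_lt {t s : ℕ} (ht : W.FirstTurn t) (hs : W.LastTurn s) (hts : t < s) :
    W.X t < W.X s := by
  by_contra! h
  have hm := W.m_eq
  have o := hs.onSlit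
  have p := ht.pos le_rfl
  have hsN := hs.2.1
  have c := ht.pos (n := (W.X s).toNat) (by omega)
  have := W.eq_of_coord_eq (i := (W.X s).toNat) (j := s) (by omega) (by omega)
    (by have := o.2.1; omega) (by rw [c.2, o.1])
  omega

/-- If both ends of the walk begin with a vertical run followed by a horizontal step towards the
inside, then the bound can be improved by one. -/
theorem k_add_two_le_of_stairs {t s r r' : ℕ} (ht : W.FirstTurn t) (hs : W.LastTurn s)
    (hk : W.k ≠ 0) (htr : t < r) (hrN : r ≤ W.N) (hrun : ∀ n, t ≤ n → n < r → W.D n = 1)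
    (hr : W.D r = 0) (hrs : r' + 1 < s) (hrun' : ∀ n, r' < n → n < s → W.D n = 4 * W.k - 1)
    (hr' : W.D r' = 4 * W.k) : W.k + 2 ≤ W.a := by
  obtain ⟨j, -, hj, hY, hlab⟩ := W.exists_low hk
  have hm := W.m_eq
  have htj := ht.lt_of_neg hY
  have hjs := hs.gt_of_neg (by omega) hY
  have ht1 := ht.1
  have hsN := hs.2.1
  have hXt := ht.onSlit
  have hXs := hs.onSlit
  by_contra! hlt
  have hcard : (W.slit.card : ℤ) = W.a - 1 ∧ W.a - 1 ≤ W.k := by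
    have h1 := k_add_two_le_of_gain ht hs hj.le hY hlab
    have h2 := W.card_slit_le
    split_ifs at h1 <;> omega
  have hgain : ∀ p ∈ W.slit, p ≠ t - 1 → p ≠ s - 1 → W.gain j p = 1 := by
    intro p hp hpt hps
    have h := W.k_add_deficit_le hj.le hlab (U := {p, t - 1, s - 1})
      (by simp [Finset.insert_subset_iff, ht.mem_slit, hs.mem_slit, hp])
    rw [Finset.sum_insert (by simp [hpt, hps]), Finset.sum_pair (by omega), ht.gain htj] at h
    have := hs.gain_le hjs
    have := W.gain_le_one j p
    split_ifs at h <;> omega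
  have hsurj : ∀ x, 0 < x → x < W.a → ∃ p ∈ W.slit, W.X (p + 1) = x := by
    intro x h0 h1
    have : W.slit.image (fun p => W.X (p + 1)) = Finset.Ioo 0 W.a :=
      Finset.eq_of_subset_of_card_le W.image_slit_subset
        (by rw [card_image_slit, Int.card_Ioo]; omega)
    exact Finset.mem_image.1 (this ▸ Finset.mem_Ioo.2 ⟨h0, h1⟩)
  have hcol : ∀ x, W.X t < x → x < W.X s → W.Col j x 1 ∨ W.Col j x (-1) := by
    intro x hx1 hx2
    obtain ⟨p, hp, rfl⟩ := hsurj x (by have := hXt.2.1; omega) (by have := hXs.2.2; omega)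
    obtain ⟨hpN, hpS⟩ := W.mem_slit.1 hp
    have hpt : p ≠ t - 1 := by
      rintro rfl
      rw [show t - 1 + 1 = t by omega] at hx1
      omega
    have hps : p ≠ s - 1 := by
      rintro rfl
      rw [show s - 1 + 1 = s by omega] at hx2
      omega
    have g := hgain p hp hpt hps
    have hpj : p + 1 ≠ j := by
      rintro rfl
      have := hpS.1
      omega
    have hpN' : p + 1 ≠ W.N := by
      intro h
      have d := W.D_last
      have x := W.X_last
      have st := W.step W.N (by omega)
      rw [← hm] at st
      have c := hs.pos (n := 1) (by omega)
      rw [show W.m - 1 = p + 1 by omega] at c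
      have := hXs.2.2
      push_cast at c
      omega
    unfold AxisWalk.gain at g
    rcases lt_or_ge p j with hlt | hge
    · rw [if_pos hlt] at g
      by_cases hup : W.D (p + 1) % 4 = 1
      · exact col_of_up (by omega) hpS.1 hup hlt
      exfalso
      have hd : W.D (p + 1) % 4 = 0 := by
        unfold jump at g
        rw [if_pos hpS] at g
        split_ifs at g <;> omega
      have st := W.step (p + 1) (by omega)
      have hpS' : W.OnSlit (p + 1 + 1) := by
        have := hpS
        have := hXs.2.2
        unfold OnSlit at *
        omega
      have hq : p + 1 ∈ W.slit := W.mem_slit.2 ⟨by omega, hpS'⟩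
      have g' := hgain (p + 1) hq
        (by
          intro h
          have c1 := ht.pos le_rfl
          have c2 := ht.pos (n := p + 1) (by omega)
          omega) (by omega)
      unfold AxisWalk.gain jump at g'
      rw [if_pos (by omega), if_pos hpS'] at g'
      split_ifs at g' <;> omega
    · rw [if_neg (by omega)] at g
      by_cases hdown : W.D p % 4 = 3
      · exact col_of_down hpN hpS.1 hdown hge
      exfalso
      have hd : W.D p % 4 = 0 := by
        unfold jump at g
        rw [if_pos hpS] at g
        split_ifs at g <;> omega
      have st := W.step p (by omega)
      have hpS' : W.OnSlit p := by
        have := hpS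
        have := hXt.2.1
        unfold OnSlit at *
        omega
      obtain ⟨p, rfl⟩ : ∃ i, p = i + 1 := ⟨p - 1, by omega⟩
      have hjp : p + 1 ≠ j := by
        rintro rfl
        have := hpS'.1
        omega
      have hq : p ∈ W.slit := W.mem_slit.2 ⟨by omega, hpS'⟩
      have g' := hgain p hq (by omega)
        (by intro h; rw [show p + 1 = s by omega] at st hx2 hd; omega)
      unfold AxisWalk.gain jump at g'
      rw [if_neg (by omega), if_pos hpS'] at g'
      split_ifs at g' <;> omega
  have colt : W.Col j (W.X t) 1 :=
    ⟨t, 1, _, LatticeWalk.strand_up htr (by omega) hXt.1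
      (fun n h1 h2 => by rw [hrun n h1 h2]; rfl) (by omega), by omega⟩
  have cols : W.Col j (W.X s) (-1) :=
    ⟨s, -1, _, LatticeWalk.strand_down hrs (by omega) hXs.1
      (fun n h1 h2 => by rw [hrun' n h1 h2]; omega) (by omega), by omega⟩
  have hlts := LastTurn.X_lt ht hs (by omega)
  have all : ∀ x, W.X t ≤ x → x < W.X s → W.Col j x 1 := by
    intro x hx
    induction x, hx using Int.leInduction with
    | base => intro; exact colt
    | succ x hx ih =>
      intro h
      rcases hcol (x + 1) (by omega) h with c | c
      · exact c
      · exact ((ih (by omega)).not_facing hY c).elim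
  exact (all (W.X s - 1) (by omega) (by omega)).not_facing hY (by simpa using cols)

end AxisWalk

theorem delta_succ {σ : List Turn} {i : ℕ} (h : i < σ.length) :
    delta σ (i + 1) = delta σ i + if σ.get ⟨i, h⟩ = Turn.L then 1 else -1 := by
  unfold delta
  rw [List.take_succ_eq_append_getElem h]
  simp only [List.count_append, List.get_eq_getElem]
  rcases (by cases σ[i] <;> simp : σ[i] = Turn.L ∨ σ[i] = Turn.R) with e | e <;>
    simp [e] <;> omega

theorem delta_zero (σ : List Turn) : delta σ 0 = 0 := by simp [delta]

theorem delta_length (σ : List Turn) : delta σ σ.length = excess σ := by simp [delta, excess]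

theorem delta_succ_eq_or {σ : List Turn} {i : ℕ} (h : i < σ.length) :
    delta σ (i + 1) = delta σ i + 1 ∨ delta σ (i + 1) = delta σ i - 1 := by
  rw [delta_succ h]; split_ifs <;> omega

namespace Chain

variable {σ : List Turn} (C : Chain σ)

theorem dirOf_eq {i : ℕ} (h : i ≤ σ.length) :
    (delta σ i % 4 = 0 ∧ dirOf σ C i = (1, 0)) ∨ (delta σ i % 4 = 1 ∧ dirOf σ C i = (0, 1)) ∨
    (delta σ i % 4 = 2 ∧ dirOf σ C i = (-1, 0)) ∨
    (delta σ i % 4 = 3 ∧ dirOf σ C i = (0, -1)) := by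
  induction i with
  | zero =>
    obtain ⟨t, ht, h1⟩ := C.first_seg
    simp [delta_zero, dirOf, unitDir, C.start_eq, h1, Int.sign_eq_one_of_pos ht]
  | succ i ih =>
    have h1 : dirOf σ C (i + 1) =
      (if σ.get ⟨i, h⟩ = Turn.L then rotCCW else rotCW) (dirOf σ C i) := C.turns i h
    have h2 := delta_succ (σ := σ) (i := i) h
    rw [h1]
    split_ifs at h2 ⊢ <;>
      rcases ih (by omega) with ⟨a, b⟩ | ⟨a, b⟩ | ⟨a, b⟩ | ⟨a, b⟩ <;>
      simp [b, rotCCW, rotCW] <;> omega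

/-- The length of the `i`-th segment. -/
def len (i : ℕ) : ℕ :=
  ((C.pts (i + 1)).1 - (C.pts i).1).natAbs + ((C.pts (i + 1)).2 - (C.pts i).2).natAbs

theorem pts_succ {i : ℕ} (h : i ≤ σ.length) : 0 < C.len i ∧
    ((delta σ i % 4 = 0 ∧ (C.pts (i + 1)).1 = (C.pts i).1 + C.len i ∧
      (C.pts (i + 1)).2 = (C.pts i).2) ∨
    (delta σ i % 4 = 1 ∧ (C.pts (i + 1)).1 = (C.pts i).1 ∧
      (C.pts (i + 1)).2 = (C.pts i).2 + C.len i) ∨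
    (delta σ i % 4 = 2 ∧ (C.pts (i + 1)).1 = (C.pts i).1 - C.len i ∧
      (C.pts (i + 1)).2 = (C.pts i).2) ∨
    (delta σ i % 4 = 3 ∧ (C.pts (i + 1)).1 = (C.pts i).1 ∧
      (C.pts (i + 1)).2 = (C.pts i).2 - C.len i)) := by
  have h1 := C.axis_parallel i h
  have h2 := C.dirOf_eq h
  unfold dirOf unitDir at h2
  unfold len
  simp only [Prod.mk.injEq, Int.sign_eq_one_iff_pos, Int.sign_eq_neg_one_iff_neg,
    Int.sign_eq_zero_iff_zero] at h2
  omega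

/-- The number of unit steps before the `i`-th bend. -/
def time (i : ℕ) : ℕ := ∑ j ∈ Finset.range i, C.len j

theorem time_succ (i : ℕ) : C.time (i + 1) = C.time i + C.len i := Finset.sum_range_succ _ _

theorem time_zero : C.time 0 = 0 := rfl

theorem time_mono {i j : ℕ} (h : i ≤ j) : C.time i ≤ C.time j :=
  Finset.sum_le_sum_of_subset (Finset.range_mono h)

/-- The index of the segment traversed by the `n`-th unit step. -/
def seg (n : ℕ) : ℕ := Nat.findGreatest (fun i => C.time i ≤ n) σ.length

theorem seg_time_add {i r : ℕ} (hi : i ≤ σ.length) (hr : r < C.len i) :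
    C.seg (C.time i + r) = i := by
  unfold seg
  rw [Nat.findGreatest_eq_iff]
  refine ⟨hi, fun _ => by omega, fun n hn _ => ?_⟩
  have := C.time_mono (show i + 1 ≤ n from hn)
  rw [time_succ] at this
  omega

theorem exists_seg {n : ℕ} (hn : n < C.time (σ.length + 1)) :
    ∃ i r, i ≤ σ.length ∧ r < C.len i ∧ n = C.time i + r := by
  have h1 := Nat.findGreatest_spec (P := fun i => C.time i ≤ n) (n := σ.length)
    (Nat.zero_le _) (by simp [time_zero])
  have h2 := Nat.findGreatest_le (P := fun i => C.time i ≤ n) σ.length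
  have h3 := fun j h h' => Nat.findGreatest_is_greatest (P := fun i => C.time i ≤ n)
    (n := σ.length) (k := j) h h'
  generalize Nat.findGreatest (fun i => C.time i ≤ n) σ.length = i at *
  refine ⟨i, n - C.time i, h2, ?_, by omega⟩
  have h4 := C.time_succ i
  rcases h2.eq_or_lt with rfl | h
  · omega
  · have := h3 (i + 1) (by omega) h
    omega

/-- The `n`-th lattice point along the chain. -/
def vertex (n : ℕ) : ℤ × ℤ :=
  C.pts (C.seg n) + ((n : ℤ) - C.time (C.seg n)) • dirOf σ C (C.seg n)

theorem vertex_time_add {i r : ℕ} (hi : i ≤ σ.length) (hr : r ≤ C.len i) :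
    C.vertex (C.time i + r) = C.pts i + (r : ℤ) • dirOf σ C i := by
  unfold vertex
  rcases hr.lt_or_eq with h | rfl
  · rw [C.seg_time_add hi h]; simp
  rcases hi.lt_or_eq with h | rfl
  · have h1 := (C.pts_succ (i := i + 1) h).1
    have h2 := C.seg_time_add (i := i + 1) h h1
    rw [add_zero, time_succ] at h2
    rw [h2, time_succ]
    have h3 := (C.pts_succ hi).2
    have h4 := C.dirOf_eq hi
    rcases h4 with ⟨h4, h5⟩ | ⟨h4, h5⟩ | ⟨h4, h5⟩ | ⟨h4, h5⟩ <;>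
      (rw [h5]; ext <;> simp <;> omega)
  · have h2 : C.seg (C.time σ.length + C.len σ.length) = σ.length := by
      unfold seg
      rw [Nat.findGreatest_eq_iff]
      exact ⟨le_rfl, fun _ => by omega, fun n hn hn' => by omega⟩
    rw [h2]; simp

theorem vertex_eq {i r : ℕ} (hi : i ≤ σ.length) (hr : r ≤ C.len i) :
    (delta σ i % 4 = 0 ∧ (C.vertex (C.time i + r)).1 = (C.pts i).1 + r ∧
      (C.vertex (C.time i + r)).2 = (C.pts i).2) ∨
    (delta σ i % 4 = 1 ∧ (C.vertex (C.time i + r)).1 = (C.pts i).1 ∧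
      (C.vertex (C.time i + r)).2 = (C.pts i).2 + r) ∨
    (delta σ i % 4 = 2 ∧ (C.vertex (C.time i + r)).1 = (C.pts i).1 - r ∧
      (C.vertex (C.time i + r)).2 = (C.pts i).2) ∨
    (delta σ i % 4 = 3 ∧ (C.vertex (C.time i + r)).1 = (C.pts i).1 ∧
      (C.vertex (C.time i + r)).2 = (C.pts i).2 - r) := by
  rw [C.vertex_time_add hi hr]
  rcases C.dirOf_eq hi with ⟨h4, h5⟩ | ⟨h4, h5⟩ | ⟨h4, h5⟩ | ⟨h4, h5⟩ <;>
    simp [h4, h5, sub_eq_add_neg]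

theorem vertex_mem_segSet {i r : ℕ} (hi : i ≤ σ.length) (hr : r ≤ C.len i) :
    C.vertex (C.time i + r) ∈ segSet (C.pts i) (C.pts (i + 1)) := by
  have h1 := C.vertex_eq hi hr
  have h2 := (C.pts_succ hi).2
  unfold segSet
  simp only [Set.mem_ofPred_eq]
  omega

theorem vertex_inj {n n' : ℕ} (h : n < n') (hn : n' ≤ C.time (σ.length + 1)) :
    C.vertex n ≠ C.vertex n' := by
  intro heq
  obtain ⟨i, r, hi, hr, rfl⟩ := C.exists_seg (n := n) (by omega)
  obtain ⟨j, s, hj, hs, e⟩ := C.exists_seg (n := n' - 1) (by omega)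
  obtain rfl : n' = C.time j + (s + 1) := by omega
  have hij : i ≤ j := by
    by_contra! hc
    have := C.time_mono (show j + 1 ≤ i from hc)
    rw [time_succ] at this
    omega
  have mi := C.vertex_mem_segSet hi hr.le
  have mj := C.vertex_mem_segSet hj (show s + 1 ≤ C.len j from hs)
  rcases hij.eq_or_lt with rfl | hlt
  · have h1 := C.vertex_eq hi hr.le
    have h2 := C.vertex_eq hj (show s + 1 ≤ C.len i from hs)
    rw [heq] at h1
    omega
  rcases (show i + 1 ≤ j from hlt).eq_or_lt with rfl | hlt'
  · have h1 := (C.simple_adj i hj).subset ⟨mi, heq ▸ mj⟩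
    rw [Set.mem_singleton_iff] at h1
    have h2 := C.vertex_eq hi hr.le
    have h3 := (C.pts_succ hi).2
    rw [h1] at h2
    omega
  · exact (C.simple_nonadj i j hlt' hj).subset ⟨mi, heq ▸ mj⟩

/-- The unit-step walk along a chain that ends on the positive `x`-axis after `k` full turns. -/
def toAxisWalk {a k : ℤ} (ha : 0 < a) (hk : excess σ = 4 * k) (hσ : σ ≠ [])
    (hend : C.pts (σ.length + 1) = (a, 0)) : AxisWalk where
  m := C.time (σ.length + 1)
  X n := (C.vertex n).1
  Y n := (C.vertex n).2
  D n := delta σ (C.seg n)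
  step n hn := by
    obtain ⟨i, r, hi, hr, rfl⟩ := C.exists_seg hn
    have h1 := C.vertex_eq hi hr.le
    have h2 := C.vertex_eq hi (show r + 1 ≤ C.len i from hr)
    rw [C.seg_time_add hi hr, add_assoc]
    omega
  turn n hn := by
    obtain ⟨i, r, hi, hr, rfl⟩ := C.exists_seg (n := n) (by omega)
    rw [C.seg_time_add hi hr]
    rcases (show r + 1 ≤ C.len i from hr).lt_or_eq with h | h
    · rw [add_assoc, C.seg_time_add hi h]; omega
    · rw [add_assoc, h, ← time_succ] at hn ⊢
      have hi' : i < σ.length := by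
        by_contra! hc
        exact absurd (C.time_mono (show σ.length + 1 ≤ i + 1 by omega)) (by omega)
      have h1 := C.seg_time_add (i := i + 1) hi' (C.pts_succ (i := i + 1) hi').1
      rw [add_zero] at h1
      rw [h1]
      have := delta_succ_eq_or hi'
      omega
  inj i j h hj hx hy := C.vertex_inj h hj (Prod.ext hx hy)
  a := a
  k := k
  N := C.time (σ.length + 1) - 1
  a_pos := ha
  N_pos := by
    have h1 := (C.pts_succ (le_refl σ.length)).1
    have h2 := (C.pts_succ (Nat.zero_le σ.length)).1
    have h3 := C.time_mono (show 1 ≤ σ.length from List.length_pos_iff.2 hσ)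
    have h4 := C.time_succ σ.length
    have h5 := C.time_succ 0
    simp only [zero_add] at h5
    omega
  m_eq := by
    have h1 := (C.pts_succ (le_refl σ.length)).1
    have h4 := C.time_succ σ.length
    omega
  X_zero := by
    have h := C.vertex_time_add (Nat.zero_le _) (Nat.zero_le (C.len 0))
    rw [time_zero, C.start_eq] at h
    simp [h]
  Y_zero := by
    have h := C.vertex_time_add (Nat.zero_le _) (Nat.zero_le (C.len 0))
    rw [time_zero, C.start_eq] at h
    simp [h]
  X_last := by
    have h1 := C.vertex_eq le_rfl (le_refl (C.len σ.length))
    have h2 := (C.pts_succ (le_refl σ.length)).2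
    rw [← time_succ] at h1
    rw [hend] at h2
    omega
  Y_last := by
    have h1 := C.vertex_eq le_rfl (le_refl (C.len σ.length))
    have h2 := (C.pts_succ (le_refl σ.length)).2
    rw [← time_succ] at h1
    rw [hend] at h2
    omega
  D_zero := by
    have h := C.seg_time_add (Nat.zero_le _) (C.pts_succ (Nat.zero_le _)).1
    rw [time_zero, add_zero] at h
    rw [h, delta_zero]
  D_last := by
    have h1 := (C.pts_succ (le_refl σ.length)).1
    have h := C.seg_time_add (le_refl σ.length) (show C.len σ.length - 1 < C.len σ.length by omega)
    have h4 := C.time_succ σ.length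
    rw [show C.time (σ.length + 1) - 1 = C.time σ.length + (C.len σ.length - 1) by omega, h,
      delta_length, hk]

section Endpoints

variable {a k : ℤ} (ha : 0 < a) (hk : excess σ = 4 * k) (hσ : σ ≠ [])
  (hend : C.pts (σ.length + 1) = (a, 0))

theorem toAxisWalk_D {i r : ℕ} (hi : i ≤ σ.length) (hr : r < C.len i) :
    (C.toAxisWalk ha hk hσ hend).D (C.time i + r) = delta σ i :=
  congrArg (delta σ) (C.seg_time_add hi hr)

theorem toAxisWalk_D_time {i : ℕ} (hi : i ≤ σ.length) :
    (C.toAxisWalk ha hk hσ hend).D (C.time i) = delta σ i :=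
  C.toAxisWalk_D ha hk hσ hend hi (C.pts_succ hi).1

theorem toAxisWalk_D_of_mem {i n : ℕ} (hi : i ≤ σ.length) (h : C.time i ≤ n)
    (h' : n < C.time (i + 1)) : (C.toAxisWalk ha hk hσ hend).D n = delta σ i := by
  rw [time_succ] at h'
  obtain ⟨r, rfl⟩ := Nat.exists_eq_add_of_le h
  exact C.toAxisWalk_D ha hk hσ hend hi (by omega)

theorem toAxisWalk_N_succ :
    (C.toAxisWalk ha hk hσ hend).N + 1 = C.time (σ.length + 1) :=
  (C.toAxisWalk ha hk hσ hend).m_eq.symm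

theorem time_lt {i j : ℕ} (h : i < j) (hj : j ≤ σ.length + 1) : C.time i < C.time j := by
  have h1 := C.time_mono (show i + 1 ≤ j from h)
  have h2 := (C.pts_succ (show i ≤ σ.length by omega)).1
  rw [time_succ] at h1
  omega

theorem toAxisWalk_firstTurn : (C.toAxisWalk ha hk hσ hend).FirstTurn (C.time 1) := by
  have hl : 0 < σ.length := List.length_pos_iff.2 hσ
  have hN := C.toAxisWalk_N_succ ha hk hσ hend
  have h1 := C.time_lt (i := 1) (j := σ.length + 1) (by omega) le_rfl
  refine ⟨C.time_lt zero_lt_one (by omega), by omega, fun n hn => ?_, ?_⟩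
  · rw [C.toAxisWalk_D_of_mem ha hk hσ hend (Nat.zero_le _) (Nat.zero_le _) hn, delta_zero]
  · rw [C.toAxisWalk_D_time ha hk hσ hend hl]
    have := delta_succ_eq_or hl
    rw [delta_zero, zero_add] at this
    change delta σ 1 ≠ 0
    omega

theorem toAxisWalk_lastTurn :
    (C.toAxisWalk ha hk hσ hend).LastTurn (C.time σ.length) := by
  have hl : 0 < σ.length := List.length_pos_iff.2 hσ
  have hN := C.toAxisWalk_N_succ ha hk hσ hend
  have h1 := C.time_lt (i := σ.length) (j := σ.length + 1) (by omega) le_rfl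
  have h2 := C.time_lt (i := σ.length - 1) (j := σ.length) (by omega) (by omega)
  refine ⟨by omega, by omega, fun n hn hn' => ?_, ?_⟩
  · rw [C.toAxisWalk_D_of_mem ha hk hσ hend le_rfl hn (by omega), delta_length, hk]
    rfl
  · rw [C.toAxisWalk_D_of_mem ha hk hσ hend (i := σ.length - 1) (by omega) (by omega)
      (by rw [Nat.sub_add_cancel hl]; omega)]
    have := delta_succ_eq_or (σ := σ) (i := σ.length - 1) (by omega)
    rw [Nat.sub_add_cancel hl, delta_length, hk] at this
    change delta σ _ ≠ 4 * k
    omega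

end Endpoints

theorem two_le_length (hm : excess σ % 4 = 0) (hσ : σ ≠ []) : 2 ≤ σ.length := by
  have hl : 0 < σ.length := List.length_pos_iff.2 hσ
  by_contra! hc
  have h1 := delta_succ_eq_or hl
  rw [show 0 + 1 = σ.length by omega, delta_length, delta_zero] at h1
  omega

/-- The first and the last segment are disjoint parts of the segment joining the endpoints. -/
theorem first_lt_last {a : ℤ} (ha : 0 < a) (hm : excess σ % 4 = 0) (hσ : σ ≠ [])
    (hend : C.pts (σ.length + 1) = (a, 0)) :
    (C.pts 1).2 = 0 ∧ (C.pts σ.length).2 = 0 ∧ 0 < (C.pts 1).1 ∧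
      (C.pts 1).1 < (C.pts σ.length).1 ∧ (C.pts σ.length).1 < a := by
  have h2 := two_le_length hm hσ
  have h0 := C.start_eq
  obtain ⟨t, ht, h1⟩ := C.first_seg
  obtain ⟨hl, hL⟩ := C.pts_succ (le_refl σ.length)
  rw [delta_length, hend] at hL
  have hd := C.simple_nonadj 0 σ.length (by omega) le_rfl
  rw [zero_add, h0, h1, hend] at hd
  refine ⟨by simp [h1], by omega, by simpa [h1] using ht, ?_, by omega⟩
  by_contra! hc
  refine Set.eq_empty_iff_forall_notMem.1 hd (min t a, 0) ⟨?_, ?_⟩ <;> rw [h1] at hc <;>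
    simp only [segSet, Set.mem_ofPred_eq] <;> omega

theorem three_le {a : ℤ} (ha : 0 < a) (hm : excess σ % 4 = 0) (hσ : σ ≠ [])
    (hend : C.pts (σ.length + 1) = (a, 0)) : 3 ≤ a := by
  have := C.first_lt_last ha hm hσ hend
  omega

theorem exists_lt_of_two_le_card {p : ℕ → Prop} (h : 2 ≤ Nat.card {i // p i}) :
    ∃ i j, i < j ∧ p i ∧ p j := by
  have : Finite {i // p i} := Nat.finite_of_card_ne_zero (by omega)
  obtain ⟨⟨i, hi⟩, ⟨j, hj⟩, hij⟩ := (Finite.one_lt_card_iff_nontrivial.1 h).exists_pair_ne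
  rcases lt_or_gt_of_ne (fun e => hij (Subtype.ext e) : i ≠ j) with h | h
  · exact ⟨i, j, h, hi, hj⟩
  · exact ⟨j, i, h, hj, hi⟩

theorem dirOf_eq_east {i : ℕ} (h : i ≤ σ.length) (hd : dirOf σ C i = (1, 0)) :
    delta σ i % 4 = 0 := by
  have := C.dirOf_eq h
  rw [hd] at this
  simpa using this

theorem dirOf_eq_vertical {i : ℕ} {e : ℤ} (he : e = 1 ∨ e = -1) (h : i ≤ σ.length)
    (hd : dirOf σ C i = (0, e)) : delta σ i % 4 = e % 4 := by
  have := C.dirOf_eq h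
  rw [hd] at this
  rcases he with rfl | rfl <;> simpa using this

theorem delta_of_two_le_stairCountO {e : ℤ} (he : e = 1 ∨ e = -1)
    (h : 2 ≤ stairCountO σ C (1, 0) (0, e)) :
    3 ≤ σ.length ∧ delta σ 1 = e ∧ delta σ 2 = 0 ∧ delta σ 3 = e := by
  obtain ⟨i, j, hij, ⟨hi, di, -⟩, ⟨hj, dj, hall⟩⟩ := exists_lt_of_two_le_card h
  have mi := C.dirOf_eq_vertical he hi di
  have mj := C.dirOf_eq_vertical he hj dj
  have all : ∀ l ≤ j, delta σ l % 4 = 0 ∨ delta σ l % 4 = e % 4 := fun l hl =>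
    (hall l hl).imp (C.dirOf_eq_east (by omega)) (C.dirOf_eq_vertical he (by omega))
  have d0 := delta_zero σ
  have hi0 : i ≠ 0 := by rintro rfl; omega
  have hij' : j ≠ i + 1 := by
    rintro rfl
    have := delta_succ_eq_or (σ := σ) (i := i) (by omega)
    omega
  have s0 := delta_succ_eq_or (σ := σ) (i := 0) (by omega)
  have s1 := delta_succ_eq_or (σ := σ) (i := 1) (by omega)
  have s2 := delta_succ_eq_or (σ := σ) (i := 2) (by omega)
  have a1 := all 1 (by omega)
  have a2 := all 2 (by omega)
  have a3 := all 3 (by omega)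
  norm_num at s0 s1 s2
  omega

theorem delta_of_two_le_stairCountP {e : ℤ} (he : e = 1 ∨ e = -1) (hm : excess σ % 4 = 0)
    (h : 2 ≤ stairCountP σ C (1, 0) (0, e)) :
    3 ≤ σ.length ∧ delta σ (σ.length - 1) = excess σ + e ∧
      delta σ (σ.length - 2) = excess σ := by
  obtain ⟨i, j, hij, ⟨hi, di, hall⟩, ⟨hj, dj, -⟩⟩ := exists_lt_of_two_le_card h
  have mi := C.dirOf_eq_vertical he hi di
  have mj := C.dirOf_eq_vertical he hj dj
  have all : ∀ l, i ≤ l → l ≤ σ.length → delta σ l % 4 = 0 ∨ delta σ l % 4 = e % 4 :=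
    fun l hl hl' =>
      (hall l hl hl').imp (C.dirOf_eq_east hl') (C.dirOf_eq_vertical he hl')
  have dL := delta_length σ
  have hj0 : j ≠ σ.length := by rintro rfl; omega
  have hij' : j ≠ i + 1 := by
    rintro rfl
    have := delta_succ_eq_or (σ := σ) (i := i) (by omega)
    omega
  have s0 := delta_succ_eq_or (σ := σ) (i := σ.length - 1) (by omega)
  have s1 := delta_succ_eq_or (σ := σ) (i := σ.length - 2) (by omega)
  rw [show σ.length - 1 + 1 = σ.length by omega] at s0
  rw [show σ.length - 2 + 1 = σ.length - 1 by omega] at s1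
  have a1 := all (σ.length - 1) (by omega) (by omega)
  have a2 := all (σ.length - 2) (by omega) (by omega)
  omega

theorem k_add_two_le_of_stairs {a k : ℤ} (ha : 0 < a) (hk : excess σ = 4 * k) (hk0 : k ≠ 0)
    (hend : C.pts (σ.length + 1) = (a, 0)) (ho : 2 ≤ stairCountO σ C (1, 0) (0, 1))
    (hp : 2 ≤ stairCountP σ C (1, 0) (0, -1)) : k + 2 ≤ a := by
  obtain ⟨hl, d1, d2, -⟩ := C.delta_of_two_le_stairCountO (.inl rfl) ho
  obtain ⟨-, e1, e2⟩ := C.delta_of_two_le_stairCountP (.inr rfl) (by omega) hp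
  have hσ : σ ≠ [] := by rintro rfl; simp at hl
  have hN := C.toAxisWalk_N_succ ha hk hσ hend
  have t1 := C.time_lt (i := 1) (j := 2) (by omega) (by omega)
  have t2 := C.time_lt (i := 2) (j := σ.length + 1) (by omega) le_rfl
  have t3 := C.time_lt (i := σ.length - 2) (j := σ.length - 1) (by omega) (by omega)
  have t4 := C.time_lt (i := σ.length - 1) (j := σ.length) (by omega) (by omega)
  refine AxisWalk.k_add_two_le_of_stairs (W := C.toAxisWalk ha hk hσ hend) (t := C.time 1)
    (s := C.time σ.length) (r := C.time 2) (r' := C.time (σ.length - 1) - 1)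
    (C.toAxisWalk_firstTurn ha hk hσ hend) (C.toAxisWalk_lastTurn ha hk hσ hend) hk0 t1
    (by omega) (fun n h h' => ?_) ?_ (by omega) (fun n h h' => ?_) ?_
  · rw [C.toAxisWalk_D_of_mem ha hk hσ hend (by omega) h h', d1]
  · rw [C.toAxisWalk_D_time ha hk hσ hend (by omega), d2]
  · rw [C.toAxisWalk_D_of_mem ha hk hσ hend (i := σ.length - 1) (by omega) (by omega)
      (by rwa [Nat.sub_add_cancel (by omega)]), e1, hk]
    rfl
  · rw [C.toAxisWalk_D_of_mem ha hk hσ hend (i := σ.length - 2) (by omega) (by omega)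
      (by rw [show σ.length - 2 + 1 = σ.length - 1 by omega]; omega), e2, hk]
    rfl

theorem four_le_of_stairs {a e : ℤ} (ha : 0 < a) (he : e = 1 ∨ e = -1) (hm : excess σ = 0)
    (hend : C.pts (σ.length + 1) = (a, 0)) (ho : 2 ≤ stairCountO σ C (1, 0) (0, e))
    (hp : 2 ≤ stairCountP σ C (1, 0) (0, -e)) : 4 ≤ a := by
  obtain ⟨hl, d1, d2, d3⟩ := C.delta_of_two_le_stairCountO he ho
  obtain ⟨-, e1, e2⟩ := C.delta_of_two_le_stairCountP (by omega) (by omega) hp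
  have hσ : σ ≠ [] := by rintro rfl; simp at hl
  obtain ⟨y1, yL, x1, x1L, xL⟩ := C.first_lt_last ha (by omega) hσ hend
  by_contra! hlt
  have l3 : σ.length ≠ 3 := by intro h; rw [h] at e1; norm_num at e1; omega
  have l4 : σ.length ≠ 4 := by intro h; rw [h] at e1; norm_num at e1; omega
  have s1 := C.pts_succ (i := 1) (by omega)
  have s2 := C.pts_succ (i := 2) (by omega)
  have sL1 := C.pts_succ (i := σ.length - 1) (by omega)
  have sL2 := C.pts_succ (i := σ.length - 2) (by omega)
  have n1 := C.simple_nonadj 1 (σ.length - 2) (by omega) (by omega)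
  have n2 := C.simple_nonadj 2 (σ.length - 1) (by omega) (by omega)
  rw [show σ.length - 1 + 1 = σ.length by omega] at sL1 n2
  rw [show σ.length - 2 + 1 = σ.length - 1 by omega] at sL2 n1
  norm_num at s1 s2 n1 n2
  rw [d1] at s1
  rw [d2] at s2
  rw [e1] at sL1
  rw [e2] at sL2
  rcases le_total (C.len 1) (C.len (σ.length - 1)) with h | h
  · refine Set.eq_empty_iff_forall_notMem.1 n2 (2, (C.pts 2).2) ⟨?_, ?_⟩ <;>
      simp only [segSet, Set.mem_ofPred_eq] <;> rcases he with rfl | rfl <;> omega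
  · refine Set.eq_empty_iff_forall_notMem.1 n1 (1, (C.pts (σ.length - 1)).2) ⟨?_, ?_⟩ <;>
      simp only [segSet, Set.mem_ofPred_eq] <;> rcases he with rfl | rfl <;> omega

end Chain

theorem delta_one_of_head? {σ : List Turn} {t : Turn} (h : σ.head? = some t) :
    delta σ 1 = if t = Turn.L then 1 else -1 := by
  cases σ with
  | nil => simp at h
  | cons u τ =>
    obtain rfl : u = t := by simpa using h
    rw [← zero_add 1, delta_succ (by simp), delta_zero]
    simp

/-- **Lower bound on the closest reachable point on the `+x`-axis when
`l - r ≡ 0 (mod 4)`.** -/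
theorem lower_bound_x_plus_mod_zero (σ : List Turn) (h0 : 0 ≤ excess σ)
    (hm : excess σ % 4 = 0) (C : Chain σ) (a : ℤ) (ha : 0 < a)
    (hend : C.pts (σ.length + 1) = (a, 0)) :
    (8 ≤ excess σ → σ.head? = some Turn.L →
      ((min (stairCountO σ C (1, 0) (0, 1))
          (min (stairCountP σ C (1, 0) (0, -1)) 2) : ℕ) : ℤ) +
        (excess σ + 2) / 4 ≤ a) ∧
    (8 ≤ excess σ → σ.head? = some Turn.R → (excess σ + 2) / 4 + 2 ≤ a) ∧
    (excess σ = 0 → σ.head? = some Turn.L →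
      ((min (stairCountO σ C (1, 0) (0, 1))
          (min (stairCountP σ C (1, 0) (0, -1)) 2) : ℕ) : ℤ) + 2 ≤ a) ∧
    (excess σ = 0 → σ.head? = some Turn.R →
      ((min (stairCountO σ C (1, 0) (0, -1))
          (min (stairCountP σ C (1, 0) (0, 1)) 2) : ℕ) : ℤ) + 2 ≤ a) ∧
    (excess σ = 4 → 3 ≤ a) := by
  obtain ⟨k, hk⟩ : ∃ k, excess σ = 4 * k := ⟨excess σ / 4, by omega⟩
  have three : σ ≠ [] → 3 ≤ a := fun hσ => C.three_le ha hm hσ hend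
  have ne_nil : ∀ {t}, σ.head? = some t → σ ≠ [] := by rintro t h rfl; simp at h
  refine ⟨fun h8 hL => ?_, fun h8 hR => ?_, fun h hL => ?_, fun h hR => ?_, fun h4 => ?_⟩
  · have h1 : k + 1 ≤ a := AxisWalk.k_add_one_le
      (C.toAxisWalk_firstTurn ha hk (ne_nil hL) hend)
      (C.toAxisWalk_lastTurn ha hk (ne_nil hL) hend) (show k ≠ 0 by omega)
    have h2 := C.k_add_two_le_of_stairs ha hk (by omega) hend
    omega
  · have h1 : k + 2 ≤ a := AxisWalk.k_add_two_le_of_right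
      (C.toAxisWalk_firstTurn ha hk (ne_nil hR) hend)
      (C.toAxisWalk_lastTurn ha hk (ne_nil hR) hend) (show k ≠ 0 by omega)
      (by
        have hl := List.length_pos_iff.2 (ne_nil hR)
        rw [C.toAxisWalk_D_time ha hk (ne_nil hR) hend hl, delta_one_of_head? hR]
        simp)
    omega
  · have h1 := three (ne_nil hL)
    have h2 := C.four_le_of_stairs ha (.inl rfl) h hend
    omega
  · have h1 := three (ne_nil hR)
    have h2 := C.four_le_of_stairs ha (.inr rfl) h hend
    rw [neg_neg] at h2
    omega
  · exact three (by rintro rfl; simp [excess] at h4)
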